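/- There exist constants L ≥ 2 and η > 0, depending only on n, M, β, with the following property: for every admissible drift B and every Green's function g of L = −Δ + B·∇ on Ω with pole at 0, setting s* = max { g(x) : x ∈ Ω, |x| = 1/L }, the Lebesgue measure of the set { x ∈ Ω : g(x) ≥ 2s* } is at least η times the Lebesgue measure of the ball B(0, 1/L). -/

import Mathlib

open Set Metric MeasureTheory Filter
open scoped RealInnerProductSpace Topology

noncomputable section

/-- Euclidean space `ℝⁿ`. -/
abbrev Euc (n : ℕ) := EuclideanSpace ℝ (Fin n)

/-- The divergence `div B x = ∑ i ∂ᵢ Bᵢ (x)` of a vector field. -/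
def divg {n : ℕ} (B : Euc n → Euc n) (x : Euc n) : ℝ :=
  ∑ i : Fin n, ⟪fderiv ℝ B x (EuclideanSpace.single i 1), EuclideanSpace.single i (1 : ℝ)⟫

/-- An admissible drift on the unit ball `Ω = B(0,1)`: `B` is continuously differentiable on
`Ω`, `δ(x)^(1-β) |B(x)| ≤ M` on `Ω` (where `δ(x) = 1 - |x|`), and
`-M δ(x)^(β-2) ≤ div B(x) ≤ 0` on `Ω`. -/
def AdmissibleDrift {n : ℕ} (β M : ℝ) (B : Euc n → Euc n) : Prop :=
  ContDiffOn ℝ 1 B (ball 0 1) ∧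
  (∀ x ∈ ball (0 : Euc n) 1, (1 - ‖x‖) ^ (1 - β) * ‖B x‖ ≤ M) ∧
  (∀ x ∈ ball (0 : Euc n) 1, -(M * (1 - ‖x‖) ^ (β - 2)) ≤ divg B x ∧ divg B x ≤ 0)

/-- A Green's function of `L = -Δ + B·∇` on the unit ball `Ω = B(0,1)` with pole at `y`:
positive on `Ω \ {y}`, three times continuously differentiable there, `g` and `|∇g|`
integrable on `Ω`, `g(x) → 0` as `|x| → 1`, and the weak formulation
`∫_Ω (⟨∇g, ∇φ⟩ + ⟨B, ∇g⟩ φ) = φ(y)` for every test function `φ ∈ C_c^∞(Ω)`. -/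
def IsGreenPole {n : ℕ} (B : Euc n → Euc n) (y : Euc n) (g : Euc n → ℝ) : Prop :=
  (∀ x ∈ ball (0 : Euc n) 1, x ≠ y → 0 < g x) ∧
  ContDiffOn ℝ 3 g (ball 0 1 \ {y}) ∧
  IntegrableOn g (ball 0 1) ∧
  IntegrableOn (fun x => ‖gradient g x‖) (ball 0 1) ∧
  (∀ ε > 0, ∃ t < (1 : ℝ), ∀ x ∈ ball (0 : Euc n) 1, t < ‖x‖ → |g x| < ε) ∧
  (∀ φ : Euc n → ℝ, ContDiff ℝ (⊤ : ℕ∞) φ → HasCompactSupport φ → tsupport φ ⊆ ball 0 1 →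
    (∫ x in ball (0 : Euc n) 1,
      (⟪gradient g x, gradient φ x⟫ + ⟪B x, gradient g x⟫ * φ x)) = φ y)

theorem exists_smooth_convex_cutoff {ε : ℝ} (hε : 0 ≤ ε) :
    ∃ H h h' : ℝ → ℝ, (∀ s, HasDerivAt H (h s) s) ∧ (∀ s, HasDerivAt h (h' s) s) ∧
      ContDiff ℝ (⊤ : ℕ∞) H ∧ (∀ s, 0 ≤ h' s) ∧ (∀ s, 0 ≤ h s) ∧ (∀ s, h s ≤ 1) ∧
      (∀ s ≤ ε, H s = 0 ∧ h s = 0 ∧ h' s = 0) ∧ (∀ s, ε < s → 0 < H s) ∧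
      (∀ s, 0 ≤ H s) ∧ (∀ s, H s ≤ |s|) := by
  set h : ℝ → ℝ := fun s => Real.smoothTransition (s - ε) with hh
  have hcd : ContDiff ℝ (⊤ : ℕ∞) h :=
    Real.smoothTransition.contDiff.comp (contDiff_id.sub contDiff_const)
  have hcont : Continuous h := hcd.continuous
  set H : ℝ → ℝ := fun s => ∫ t in ε..s, h t with hH
  have hHd : ∀ s, HasDerivAt H (h s) s := fun s =>
    intervalIntegral.integral_hasDerivAt_right (hcont.intervalIntegrable _ _)
      (hcont.stronglyMeasurableAtFilter _ _) hcont.continuousAt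
  have hdiff : Differentiable ℝ h := hcd.differentiable (by simp)
  have hmono : Monotone h := fun a b hab =>
    Real.smoothTransition.monotone (by linarith)
  have hzero : ∀ s ≤ ε, h s = 0 := fun s hs =>
    Real.smoothTransition.zero_of_nonpos (by linarith)
  have hnn : ∀ s, 0 ≤ h s := fun s => Real.smoothTransition.nonneg _
  have hHz : ∀ s ≤ ε, H s = 0 := by
    intro s hs
    simp only [hH]
    rw [intervalIntegral.integral_congr (g := fun _ => (0 : ℝ))]
    · simp
    · intro t ht
      rw [uIcc_of_ge hs] at ht
      exact hzero t ht.2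
  have hHpos : ∀ s, ε < s → 0 < H s := by
    intro s hs
    refine intervalIntegral.intervalIntegral_pos_of_pos_on (hcont.intervalIntegrable _ _) ?_ hs
    intro t ht
    exact Real.smoothTransition.pos_of_pos (by linarith [ht.1])
  have hHnn : ∀ s, 0 ≤ H s := fun s => by
    rcases le_or_gt s ε with hs | hs
    · exact (hHz s hs).ge
    · exact (hHpos s hs).le
  refine ⟨H, h, deriv h, hHd, fun s => (hdiff s).hasDerivAt, ?_, fun s => hmono.deriv_nonneg,
    hnn, fun s => Real.smoothTransition.le_one _, ?_, hHpos, hHnn, ?_⟩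
  · rw [contDiff_infty_iff_deriv]
    refine ⟨fun s => (hHd s).differentiableAt, ?_⟩
    rwa [show deriv H = h from funext fun s => (hHd s).deriv]
  · intro s hs
    refine ⟨hHz s hs, hzero s hs, ?_⟩
    refine IsLocalMin.deriv_eq_zero (Eventually.of_forall fun t => ?_)
    rw [hzero s hs]
    exact hnn t
  · intro s
    rcases le_or_gt s ε with hs | hs
    · rw [hHz s hs]; exact abs_nonneg _
    · have : H s ≤ ∫ t in ε..s, (1 : ℝ) :=
        intervalIntegral.integral_mono_on hs.le (hcont.intervalIntegrable _ _)
          intervalIntegrable_const fun t _ => Real.smoothTransition.le_one _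
      simp at this
      linarith [le_abs_self s]

theorem Euc.nontrivial {n : ℕ} (hn : 3 ≤ n) : Nontrivial (Euc n) := by
  have : Nonempty (Fin n) := ⟨⟨0, by omega⟩⟩
  infer_instance

theorem Euc.ae_ne_zero {n : ℕ} (hn : 3 ≤ n) : ∀ᵐ x : Euc n, x ≠ 0 := by
  have := Euc.nontrivial hn
  exact compl_mem_ae_iff.2 (measure_singleton (0 : Euc n))

/-- The rescaled arctangent `t ↦ k * arctan (t / k)`, a bounded truncation of the identity. -/
def arctanTrunc (k t : ℝ) : ℝ := k * Real.arctan (t / k)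

theorem hasDerivAt_arctanTrunc {k : ℝ} (hk : k ≠ 0) (t : ℝ) :
    HasDerivAt (arctanTrunc k) (1 / (1 + (t / k) ^ 2)) t := by
  have h := (((hasDerivAt_id t).div_const k).arctan).const_mul k
  refine h.congr_deriv ?_
  simp only [id]
  field_simp

theorem abs_arctanTrunc_le (k t : ℝ) (hk : 0 < k) : |arctanTrunc k t| ≤ |t| := by
  have h : ∀ s : ℝ, |Real.arctan s| ≤ |s| := by
    intro s
    have := Convex.norm_image_sub_le_of_norm_deriv_le (f := Real.arctan) (s := univ) (C := 1)
      (x := 0) (y := s) (fun x _ => Real.differentiable_arctan x)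
      (fun x _ => by
        rw [Real.deriv_arctan, Real.norm_of_nonneg (by positivity), div_le_one (by positivity)]
        nlinarith [sq_nonneg x]) convex_univ (mem_univ _) (mem_univ _)
    simpa using this
  unfold arctanTrunc
  rw [abs_mul, abs_of_pos hk]
  calc k * |Real.arctan (t / k)| ≤ k * |t / k| := mul_le_mul_of_nonneg_left (h _) hk.le
    _ = |t| := by rw [abs_div, abs_of_pos hk]; field_simp

theorem abs_arctanTrunc_le_mul (k t : ℝ) (hk : 0 < k) : |arctanTrunc k t| ≤ k * 2 := by
  unfold arctanTrunc
  rw [abs_mul, abs_of_pos hk]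
  gcongr
  rw [abs_le]
  constructor <;> linarith [Real.neg_pi_div_two_lt_arctan (t / k), Real.arctan_lt_pi_div_two (t / k),
    Real.pi_lt_four]

theorem tendsto_arctanTrunc (t : ℝ) :
    Tendsto (fun m : ℕ => arctanTrunc ((m : ℝ) + 1) t) atTop (𝓝 t) := by
  have h0 : HasDerivAt Real.arctan 1 0 := by simpa using Real.hasDerivAt_arctan 0
  have hk : Tendsto (fun m : ℕ => (m : ℝ) + 1) atTop atTop :=
    tendsto_atTop_add_const_right _ _ tendsto_natCast_atTop_atTop
  rcases eq_or_ne t 0 with rfl | ht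
  · simp [arctanTrunc]
  have h1 := hasDerivAt_iff_tendsto_slope_zero.1 h0
  have h2 : Tendsto (fun m : ℕ => t / ((m : ℝ) + 1)) atTop (𝓝[≠] 0) := by
    refine tendsto_nhdsWithin_iff.2 ⟨hk.const_div_atTop t, Eventually.of_forall fun m => ?_⟩
    have : (m : ℝ) + 1 ≠ 0 := by positivity
    exact div_ne_zero ht this
  have h3 := (h1.comp h2).const_mul t
  rw [mul_one] at h3
  refine h3.congr fun m => ?_
  have : (m : ℝ) + 1 ≠ 0 := by positivity
  simp [arctanTrunc]
  field_simp

theorem tendsto_deriv_arctanTrunc (t : ℝ) :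
    Tendsto (fun m : ℕ => 1 / (1 + (t / ((m : ℝ) + 1)) ^ 2)) atTop (𝓝 1) := by
  have hk : Tendsto (fun m : ℕ => (m : ℝ) + 1) atTop atTop :=
    tendsto_atTop_add_const_right _ _ tendsto_natCast_atTop_atTop
  have h2 := ((hk.const_div_atTop t).pow 2).const_add 1
  have h3 := h2.inv₀ (by norm_num)
  simpa using h3

theorem measurable_of_differentiableAt_ne_zero {n : ℕ} {u : Euc n → ℝ}
    (hd : ∀ x ≠ 0, DifferentiableAt ℝ u x) : Measurable u := by
  refine measurable_of_continuousOn_compl_singleton 0 fun x hx => ?_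
  exact (hd x hx).continuousAt.continuousWithinAt

/-- Integration by parts for a `W^{1,1}` function which is differentiable away from the origin. -/
theorem integral_fderiv_mul_eq_of_differentiableAt_ne_zero {n : ℕ} (hn : 3 ≤ n) {u : Euc n → ℝ}
    (hd : ∀ x ≠ 0, DifferentiableAt ℝ u x) (hu : Integrable u) (hdu : Integrable (fderiv ℝ u))
    {φ : Euc n → ℝ} (hφ : ContDiff ℝ 1 φ) (hc : HasCompactSupport φ) (e : Euc n) :
    ∫ x, fderiv ℝ u x e * φ x = -∫ x, u x * fderiv ℝ φ x e := by
  have hum : Measurable u := measurable_of_differentiableAt_ne_zero hd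
  have hne := Euc.ae_ne_zero hn
  let χ : ContDiffBump (0 : Euc n) := ⟨1, 2, by norm_num, by norm_num⟩
  have hχ1 : ContDiff ℝ 1 χ := χ.contDiff
  have hχc : Continuous (fderiv ℝ χ) := hχ1.continuous_fderiv (by simp)
  have hφc : Continuous (fderiv ℝ φ) := hφ.continuous_fderiv (by simp)
  obtain ⟨C1, hC1⟩ := hc.exists_bound_of_continuous hφ.continuous
  obtain ⟨C2, hC2⟩ := (hc.fderiv (𝕜 := ℝ)).exists_bound_of_continuous hφc
  obtain ⟨C3, hC3⟩ := (χ.hasCompactSupport.fderiv (𝕜 := ℝ)).exists_bound_of_continuous hχc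
  have hC1n : 0 ≤ C1 := (norm_nonneg _).trans (hC1 0)
  have hC2n : 0 ≤ C2 := (norm_nonneg _).trans (hC2 0)
  have hC3n : 0 ≤ C3 := (norm_nonneg _).trans (hC3 0)
  set κ : ℕ → ℝ := fun m => (m : ℝ) + 1 with hκ
  have hκp : ∀ m, 0 < κ m := fun m => by positivity
  set f : ℕ → Euc n → ℝ := fun m x => arctanTrunc (κ m) (u x) with hf
  set c : ℕ → Euc n → ℝ := fun m x => χ (κ m • x) with hcdef
  have hcd : ∀ m, ContDiff ℝ 1 (c m) := fun m => hχ1.comp (contDiff_const_smul _)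
  have hfd : ∀ m, ∀ x ≠ 0, HasFDerivAt (f m)
      ((1 / (1 + (u x / κ m) ^ 2)) • fderiv ℝ u x) x := fun m x hx =>
    (hasDerivAt_arctanTrunc (hκp m).ne' (u x)).comp_hasFDerivAt x (hd x hx).hasFDerivAt
  have hcf : ∀ m x, HasFDerivAt (c m) (κ m • fderiv ℝ χ (κ m • x)) x := by
    intro m x
    have h1 := (hχ1.differentiable (by simp) (κ m • x)).hasFDerivAt
    have h2 := h1.comp x ((hasFDerivAt_id x).const_smul (κ m))
    refine h2.congr_fderiv ?_
    ext y
    simp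
  have hfm : ∀ m, Measurable (f m) := fun m => by
    have : Continuous (arctanTrunc (κ m)) := continuous_iff_continuousAt.2 fun t =>
      (hasDerivAt_arctanTrunc (hκp m).ne' t).continuousAt
    exact this.measurable.comp hum
  have hc01 : ∀ m x, |1 - c m x| ≤ 1 := fun m x => by
    rw [abs_le]
    constructor <;> linarith [χ.nonneg (x := κ m • x), χ.le_one (x := κ m • x)]
  have hd01 : ∀ m x, |1 / (1 + (u x / κ m) ^ 2)| ≤ 1 := fun m x => by
    rw [abs_of_nonneg (by positivity), div_le_one (by positivity)]
    nlinarith [sq_nonneg (u x / κ m)]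
  set g : ℕ → Euc n → ℝ := fun m x => (1 - c m x) * φ x with hg
  have hgd : ∀ m x, HasFDerivAt (g m)
      ((1 - c m x) • fderiv ℝ φ x + φ x • (-(κ m • fderiv ℝ χ (κ m • x)))) x := fun m x => by
    have h1 := ((hcf m x).const_sub 1).mul (hφ.differentiable (by simp) x).hasFDerivAt
    exact h1
  have hgC : ∀ m, ContDiff ℝ 1 (g m) := fun m => (contDiff_const.sub (hcd m)).mul hφ
  -- the three limits
  have hA : ∀ m, AEStronglyMeasurable (fun x => fderiv ℝ (f m) x e * g m x) volume := fun m =>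
    ((measurable_fderiv_apply_const ℝ (f m) e).mul (hgC m).continuous.measurable).aestronglyMeasurable
  have hduC : Integrable (fun x => ‖fderiv ℝ u x‖ * ‖e‖ * C1) := (hdu.norm.mul_const _).mul_const _
  have hAb : ∀ m, ∀ᵐ x, ‖fderiv ℝ (f m) x e * g m x‖ ≤ ‖fderiv ℝ u x‖ * ‖e‖ * C1 := fun m => by
    filter_upwards [hne] with x hx
    rw [(hfd m x hx).fderiv, norm_mul]
    simp only [hg]
    gcongr
    · rw [_root_.smul_apply, norm_smul]
      calc _ ≤ 1 * (‖fderiv ℝ u x‖ * ‖e‖) := by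
            gcongr
            · exact hd01 m x
            · exact (fderiv ℝ u x).le_opNorm e
        _ = _ := one_mul _
    · rw [norm_mul]
      calc _ ≤ 1 * C1 := by
            gcongr
            · exact hc01 m x
            · exact hC1 x
        _ = _ := one_mul _
  have hBm : ∀ m, AEStronglyMeasurable (fun x => f m x * ((1 - c m x) * fderiv ℝ φ x e)) volume :=
    fun m => ((hfm m).mul (((continuous_const.sub (hcd m).continuous).mul
      (hφc.clm_apply continuous_const)).measurable)).aestronglyMeasurable
  have huC : Integrable (fun x => |u x| * (C2 * ‖e‖)) := hu.abs.mul_const _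
  have hBb : ∀ m, ∀ᵐ x, ‖f m x * ((1 - c m x) * fderiv ℝ φ x e)‖ ≤ |u x| * (C2 * ‖e‖) := fun m => by
    refine Eventually.of_forall fun x => ?_
    rw [norm_mul, norm_mul]
    calc _ ≤ |u x| * (1 * (C2 * ‖e‖)) := by
          gcongr
          · exact abs_arctanTrunc_le _ _ (hκp m)
          · exact hc01 m x
          · exact (fderiv ℝ φ x).le_of_opNorm_le (hC2 x) e
      _ = _ := by ring
  have hcle : ∀ x ≠ (0 : Euc n), ∀ᶠ m in atTop, c m x = 0 := by
    intro x hx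
    have hk : Tendsto (fun m : ℕ => κ m * ‖x‖) atTop atTop :=
      (tendsto_atTop_add_const_right _ _ tendsto_natCast_atTop_atTop).atTop_mul_const
        (norm_pos_iff.2 hx)
    filter_upwards [hk.eventually_ge_atTop 2] with m hm
    refine χ.zero_of_le_dist ?_
    rw [dist_zero_right, norm_smul, Real.norm_of_nonneg (hκp m).le]
    exact hm
  have limA : Tendsto (fun m => ∫ x, fderiv ℝ (f m) x e * g m x) atTop
      (𝓝 (∫ x, fderiv ℝ u x e * φ x)) := by
    refine tendsto_integral_of_dominated_convergence _ hA hduC hAb ?_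
    filter_upwards [hne] with x hx
    have h1 : Tendsto (fun m => 1 / (1 + (u x / κ m) ^ 2) * fderiv ℝ u x e * φ x) atTop
        (𝓝 (1 * fderiv ℝ u x e * φ x)) :=
      ((tendsto_deriv_arctanTrunc (u x)).mul_const _).mul_const _
    rw [one_mul] at h1
    refine h1.congr' ?_
    filter_upwards [hcle x hx] with m hm
    rw [(hfd m x hx).fderiv]
    simp [hg, hm]
  have limB : Tendsto (fun m => ∫ x, f m x * ((1 - c m x) * fderiv ℝ φ x e)) atTop
      (𝓝 (∫ x, u x * fderiv ℝ φ x e)) := by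
    refine tendsto_integral_of_dominated_convergence _ hBm huC hBb ?_
    filter_upwards [hne] with x hx
    refine ((tendsto_arctanTrunc (u x)).mul_const _).congr' ?_
    filter_upwards [hcle x hx] with m hm
    simp [hf, hm]
    left; rfl
  -- the error term
  set r : ℕ → Euc n → ℝ := fun m x => f m x * (φ x * (κ m * fderiv ℝ χ (κ m • x) e)) with hr
  set D : ℝ := 2 * C1 * C3 * ‖e‖ with hD
  have hDn : 0 ≤ D := by positivity
  have hrb : ∀ m x, ‖r m x‖ ≤ (closedBall (0 : Euc n) (2 / κ m)).indicator
      (fun _ => D * κ m ^ 2) x := by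
    intro m x
    by_cases hx : x ∈ closedBall (0 : Euc n) (2 / κ m)
    · rw [indicator_of_mem hx]
      simp only [hr, norm_mul, Real.norm_of_nonneg (hκp m).le]
      calc _ ≤ (κ m * 2) * (C1 * (κ m * (C3 * ‖e‖))) := by
            have := hκp m
            gcongr
            · exact abs_arctanTrunc_le_mul _ _ (hκp m)
            · exact hC1 x
            · exact (fderiv ℝ χ _).le_of_opNorm_le (hC3 _) e
        _ = _ := by simp only [hD]; ring
    · rw [indicator_of_notMem hx]
      have : fderiv ℝ χ (κ m • x) = 0 := by
        refine image_eq_zero_of_notMem_tsupport fun h => hx ?_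
        have h2 := tsupport_fderiv_subset ℝ h
        rw [χ.tsupport_eq, mem_closedBall_zero_iff, norm_smul,
          Real.norm_of_nonneg (hκp m).le] at h2
        rw [mem_closedBall_zero_iff, le_div_iff₀ (hκp m), mul_comm]
        exact h2
      simp [hr, this]
  have hindi : ∀ m, Integrable ((closedBall (0 : Euc n) (2 / κ m)).indicator
      (fun _ => D * κ m ^ 2)) := fun m =>
    (integrable_indicator_iff isClosed_closedBall.measurableSet).2
      (integrableOn_const (measure_closedBall_lt_top.ne))
  have hri : ∀ m, Integrable (r m) := fun m => by
    refine (hindi m).mono' ?_ (Eventually.of_forall (hrb m))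
    refine ((hfm m).mul (hφ.continuous.mul (continuous_const.mul
      ((hχc.comp (continuous_const_smul _)).clm_apply continuous_const))).measurable).aestronglyMeasurable
  have limR : Tendsto (fun m => ∫ x, r m x) atTop (𝓝 0) := by
    set V : ℝ := volume.real (closedBall (0 : Euc n) 1) with hV
    have hb : ∀ m, ‖∫ x, r m x‖ ≤ D * 2 ^ n * V * (1 / κ m) := by
      intro m
      have hk1 : 1 ≤ κ m := by simp [hκ]
      refine (norm_integral_le_of_norm_le (hindi m) (Eventually.of_forall (hrb m))).trans ?_
      rw [integral_indicator isClosed_closedBall.measurableSet, setIntegral_const]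
      rw [Measure.addHaar_real_closedBall' _ _ (by have := hκp m; positivity), finrank_euclideanSpace,
        Fintype.card_fin, smul_eq_mul]
      have e1 : (2 / κ m) ^ n * κ m ^ 2 ≤ 2 ^ n * (1 / κ m) := by
        have : κ m ^ 3 ≤ κ m ^ n := pow_le_pow_right₀ hk1 hn
        have h3 := hκp m
        rw [div_pow, div_mul_eq_mul_div, mul_one_div, div_le_div_iff₀ (by positivity) h3]
        calc 2 ^ n * κ m ^ 2 * κ m = 2 ^ n * κ m ^ 3 := by ring
          _ ≤ _ := by gcongr
      calc _ = D * V * ((2 / κ m) ^ n * κ m ^ 2) := by ring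
        _ ≤ D * V * (2 ^ n * (1 / κ m)) := by gcongr
        _ = _ := by ring
    refine squeeze_zero_norm hb ?_
    have := (tendsto_one_div_add_atTop_nhds_zero_nat (𝕜 := ℝ)).const_mul (D * 2 ^ n * V)
    simpa [hκ] using this
  have key : ∀ m, ∫ x, f m x * ((1 - c m x) * fderiv ℝ φ x e)
      = (∫ x, r m x) - ∫ x, fderiv ℝ (f m) x e * g m x := by
    intro m
    have hBi : Integrable (fun x => f m x * ((1 - c m x) * fderiv ℝ φ x e)) :=
      huC.mono' (hBm m) (hBb m)
    have hfg : (fun x => f m x * fderiv ℝ (g m) x e) =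
        fun x => f m x * ((1 - c m x) * fderiv ℝ φ x e) - r m x := by
      funext x
      rw [(hgd m x).fderiv]
      simp [hr]
      ring
    have hts : ∀ x ∈ tsupport (g m), x ≠ 0 := by
      rintro x hx rfl
      have : g m =ᶠ[𝓝 0] 0 := by
        have : ∀ᶠ y in 𝓝 (0 : Euc n), κ m • y ∈ ball (0 : Euc n) 1 := by
          have hcts : Continuous fun y : Euc n => κ m • y := continuous_const_smul _
          exact hcts.continuousAt.eventually_mem (by simpa using ball_mem_nhds (0 : Euc n) one_pos)
        filter_upwards [this] with y hy
        have : c m y = 1 := χ.one_of_mem_closedBall (ball_subset_closedBall hy)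
        simp [hg, this]
      exact (notMem_tsupport_iff_eventuallyEq.2 this) hx
    have := integral_mul_fderiv_eq_neg_fderiv_mul_of_integrable (μ := volume) (f := f m) (g := g m)
      (v := e) (hduC.mono' (hA m) (hAb m)) (by rw [hfg]; exact hBi.sub (hri m)) ?_
      (fun x hx => (hfd m x (hts x hx)).differentiableAt) (fun x _ => (hgd m x).differentiableAt)
    · rw [hfg, integral_sub hBi (hri m)] at this
      linarith
    · refine (hu.abs.mul_const C1).mono' ((hfm m).mul (hgC m).continuous.measurable).aestronglyMeasurable ?_
      refine Eventually.of_forall fun x => ?_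
      rw [norm_mul]
      gcongr
      · exact abs_arctanTrunc_le _ _ (hκp m)
      · simp only [hg, norm_mul]
        calc _ ≤ 1 * C1 := by
              gcongr
              · exact hc01 m x
              · exact hC1 x
          _ = _ := one_mul _
  have hlim := limR.sub limA
  simp_rw [← key] at hlim
  have := tendsto_nhds_unique limB hlim
  linarith

/-- The Laplacian, as the sum of the second partial derivatives. -/
def lap {n : ℕ} (f : Euc n → ℝ) (x : Euc n) : ℝ :=
  ∑ i : Fin n, fderiv ℝ (fun y => fderiv ℝ f y (EuclideanSpace.single i 1)) x
    (EuclideanSpace.single i 1)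

open scoped Convolution in
/-- Convolution of real functions on `ℝⁿ`. -/
def conv {n : ℕ} (ρ U : Euc n → ℝ) : Euc n → ℝ :=
  ρ ⋆[ContinuousLinearMap.lsmul ℝ ℝ, volume] U

theorem conv_apply {n : ℕ} (ρ U : Euc n → ℝ) (x : Euc n) :
    conv ρ U x = ∫ y, ρ (x - y) * U y := by
  rw [conv, convolution_eq_swap]
  rfl

theorem contDiff_fderiv_apply {n : ℕ} {ρ : Euc n → ℝ} (hρ : ContDiff ℝ (⊤ : ℕ∞) ρ) (e : Euc n) :
    ContDiff ℝ (⊤ : ℕ∞) fun t => fderiv ℝ ρ t e :=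
  (hρ.fderiv_right (by simp)).clm_apply contDiff_const

theorem contDiff_conv {n : ℕ} {ρ U : Euc n → ℝ} (hρ : ContDiff ℝ (⊤ : ℕ∞) ρ)
    (hc : HasCompactSupport ρ) (hU : Integrable U) : ContDiff ℝ (⊤ : ℕ∞) (conv ρ U) :=
  hc.contDiff_convolution_left _ hρ hU.locallyIntegrable

theorem fderiv_conv_apply {n : ℕ} {ρ U : Euc n → ℝ} (hρ : ContDiff ℝ (⊤ : ℕ∞) ρ)
    (hc : HasCompactSupport ρ) (hU : Integrable U) (e x : Euc n) :
    fderiv ℝ (conv ρ U) x e = conv (fun t => fderiv ℝ ρ t e) U x := by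
  have h := hc.hasFDerivAt_convolution_left (ContinuousLinearMap.lsmul ℝ ℝ) (μ := volume)
    (hρ.of_le (by exact_mod_cast le_top)) hU.locallyIntegrable x
  rw [conv, h.fderiv, conv]
  have hi : ConvolutionExistsAt (fderiv ℝ ρ) U x
      ((ContinuousLinearMap.lsmul ℝ ℝ).precompL (Euc n)) volume :=
    ((hc.fderiv (𝕜 := ℝ)).convolutionExists_left _ (hρ.continuous_fderiv (by simp))
      hU.locallyIntegrable) x
  rw [convolution_def, convolution_def, ContinuousLinearMap.integral_apply hi]
  rfl

theorem fderiv_comp_sub_apply {n : ℕ} {ρ : Euc n → ℝ} (hρ : ContDiff ℝ (⊤ : ℕ∞) ρ)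
    (x y e : Euc n) : fderiv ℝ (fun z => ρ (x - z)) y e = -fderiv ℝ ρ (x - y) e := by
  have h1 := (hρ.differentiable (by simp) (x - y)).hasFDerivAt
  have h2 := h1.comp y ((hasFDerivAt_id y).const_sub x)
  have : fderiv ℝ (fun z => ρ (x - z)) y = _ := h2.fderiv
  rw [this]
  simp

theorem hasCompactSupport_comp_sub {n : ℕ} {ρ : Euc n → ℝ} (hc : HasCompactSupport ρ)
    (x : Euc n) : HasCompactSupport fun z => ρ (x - z) :=
  hc.comp_homeomorph (Homeomorph.subLeft x)

theorem lap_conv_eq {n : ℕ} (hn : 3 ≤ n) {ρ U : Euc n → ℝ} (hρ : ContDiff ℝ (⊤ : ℕ∞) ρ)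
    (hc : HasCompactSupport ρ) (hd : ∀ x ≠ 0, DifferentiableAt ℝ U x) (hU : Integrable U)
    (hdU : Integrable (fderiv ℝ U)) (x : Euc n) :
    lap (conv ρ U) x = -∫ y, ∑ i : Fin n, fderiv ℝ U y (EuclideanSpace.single i 1) *
      fderiv ℝ (fun z => ρ (x - z)) y (EuclideanSpace.single i 1) := by
  have hρ1 : ∀ i : Fin n, ContDiff ℝ (⊤ : ℕ∞)
      fun t => fderiv ℝ ρ t (EuclideanSpace.single i 1) := fun i => contDiff_fderiv_apply hρ _
  have hc1 : ∀ i : Fin n, HasCompactSupport fun t => fderiv ℝ ρ t (EuclideanSpace.single i 1) :=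
    fun i => hc.fderiv_apply ℝ _
  have hφ : ContDiff ℝ (⊤ : ℕ∞) fun z => ρ (x - z) := hρ.comp (contDiff_const.sub contDiff_id)
  have hφc := hasCompactSupport_comp_sub hc x
  rw [integral_finsetSum]
  · rw [lap, ← Finset.sum_neg_distrib]
    refine Finset.sum_congr rfl fun i _ => ?_
    simp_rw [fderiv_conv_apply hρ hc hU]
    rw [fderiv_conv_apply (hρ1 i) (hc1 i) hU, conv_apply,
      integral_fderiv_mul_eq_of_differentiableAt_ne_zero hn hd hU hdU
      ((contDiff_fderiv_apply hφ _).of_le (by exact_mod_cast le_top)) (hφc.fderiv_apply ℝ _), neg_neg]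
    refine integral_congr_ae (Eventually.of_forall fun y => ?_)
    simp only
    simp_rw [fderiv_comp_sub_apply hρ]
    rw [mul_comm]
    congr 1
    have := fderiv_comp_sub_apply (hρ1 i) x y (EuclideanSpace.single i 1)
    rw [fderiv_fun_neg, _root_.neg_apply, this, neg_neg]
  · intro i _
    obtain ⟨C, hC⟩ := (hφc.fderiv_apply ℝ (EuclideanSpace.single i 1)).exists_bound_of_continuous
      (contDiff_fderiv_apply hφ _).continuous
    exact (hdU.apply_continuousLinearMap _).mul_bdd
      (contDiff_fderiv_apply hφ _).continuous.aestronglyMeasurable (Eventually.of_forall hC)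

theorem lap_comp {n : ℕ} {H h h' : ℝ → ℝ} (hH : ∀ s, HasDerivAt H (h s) s)
    (hh : ∀ s, HasDerivAt h (h' s) s) {V : Euc n → ℝ} (hV : ContDiff ℝ (⊤ : ℕ∞) V) (x : Euc n) :
    lap (fun y => H (V y)) x = h (V x) * lap V x +
      h' (V x) * ∑ i : Fin n, (fderiv ℝ V x (EuclideanSpace.single i 1)) ^ 2 := by
  rw [lap, lap, Finset.mul_sum, Finset.mul_sum, ← Finset.sum_add_distrib]
  refine Finset.sum_congr rfl fun i _ => ?_
  have hVd : ∀ y, HasFDerivAt V (fderiv ℝ V y) y := fun y =>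
    (hV.differentiable (by simp) y).hasFDerivAt
  have h1 : ∀ y, fderiv ℝ (fun y => H (V y)) y = h (V y) • fderiv ℝ V y := fun y =>
    ((hH (V y)).comp_hasFDerivAt y (hVd y)).fderiv
  simp_rw [h1, _root_.smul_apply, smul_eq_mul]
  have h2 : HasFDerivAt (fun y => h (V y)) (h' (V x) • fderiv ℝ V x) x :=
    (hh (V x)).comp_hasFDerivAt x (hVd x)
  have h3 := ((contDiff_fderiv_apply hV (EuclideanSpace.single i 1)).differentiable
    (by simp) x).hasFDerivAt
  have h4 : fderiv ℝ (fun y => h (V y) * fderiv ℝ V y (EuclideanSpace.single i 1)) x = _ :=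
    (h2.mul h3).fderiv
  rw [h4]
  simp
  ring

/-- Green's identity for smooth functions, one of which has compact support. -/
theorem integral_mul_lap_comm {n : ℕ} {p v : Euc n → ℝ} (hp : ContDiff ℝ (⊤ : ℕ∞) p)
    (hpc : HasCompactSupport p) (hv : ContDiff ℝ (⊤ : ℕ∞) v) :
    ∫ x, p x * lap v x = ∫ x, lap p x * v x := by
  have hi : ∀ f g : Euc n → ℝ, Continuous f → Continuous g → HasCompactSupport f →
      Integrable fun x => f x * g x := fun f g hf hg hc =>
    (hf.mul hg).integrable_of_hasCompactSupport hc.mul_right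
  have hi' : ∀ f g : Euc n → ℝ, Continuous f → Continuous g → HasCompactSupport g →
      Integrable fun x => f x * g x := fun f g hf hg hc =>
    (hf.mul hg).integrable_of_hasCompactSupport hc.mul_left
  have hpp := fun e : Euc n => contDiff_fderiv_apply hp e
  have hvv := fun e : Euc n => contDiff_fderiv_apply hv e
  have hpcc := fun e : Euc n => hpc.fderiv_apply ℝ e
  simp only [lap, Finset.mul_sum, Finset.sum_mul]
  rw [integral_finsetSum, integral_finsetSum]
  · refine Finset.sum_congr rfl fun i _ => ?_
    rw [integral_mul_fderiv_eq_neg_fderiv_mul_of_integrable, integral_mul_fderiv_eq_neg_fderiv_mul_of_integrable, neg_neg]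
    · exact hi _ _ (contDiff_fderiv_apply (hpp _) _).continuous hv.continuous ((hpcc _).fderiv_apply ℝ _)
    · exact hi _ _ (hpp _).continuous (hvv _).continuous (hpcc _)
    · exact hi _ _ (hpp _).continuous hv.continuous (hpcc _)
    · exact fun x _ => (hpp _).differentiable (by simp) x
    · exact fun x _ => hv.differentiable (by simp) x
    · exact hi _ _ (hpp _).continuous (hvv _).continuous (hpcc _)
    · exact hi _ _ hp.continuous (contDiff_fderiv_apply (hvv _) _).continuous hpc
    · exact hi _ _ hp.continuous (hvv _).continuous hpc
    · exact fun x _ => hp.differentiable (by simp) x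
    · exact fun x _ => (hvv _).differentiable (by simp) x
  · exact fun i _ => hi _ _ (contDiff_fderiv_apply (hpp _) _).continuous hv.continuous ((hpcc _).fderiv_apply ℝ _)
  · exact fun i _ => hi _ _ hp.continuous (contDiff_fderiv_apply (hvv _) _).continuous hpc

/-- A form of Fatou's lemma for Bochner integrals. -/
theorem integral_le_of_tendsto_of_integral_le {α : Type*} [MeasurableSpace α] {μ : Measure α}
    {f : ℕ → α → ℝ} {F : α → ℝ} {c : ℕ → ℝ} {C : ℝ} (hf : ∀ k, Integrable (f k) μ)
    (hf0 : ∀ k x, 0 ≤ f k x) (hF : Integrable F μ)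
    (hlim : ∀ᵐ x ∂μ, Tendsto (fun k => f k x) atTop (𝓝 (F x)))
    (hc : ∀ k, ∫ x, f k x ∂μ ≤ c k) (hcC : Tendsto c atTop (𝓝 C)) : ∫ x, F x ∂μ ≤ C := by
  have hF0 : 0 ≤ᵐ[μ] F := by
    filter_upwards [hlim] with x hx
    exact ge_of_tendsto' hx fun k => hf0 k x
  have hC : 0 ≤ C := ge_of_tendsto' hcC fun k => (integral_nonneg (hf0 k)).trans (hc k)
  have h1 : ∫⁻ x, ENNReal.ofReal (F x) ∂μ ≤
      liminf (fun k => ∫⁻ x, ENNReal.ofReal (f k x) ∂μ) atTop := by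
    refine le_trans (le_of_eq ?_)
      (lintegral_liminf_le' fun k => (hf k).aestronglyMeasurable.aemeasurable.ennreal_ofReal)
    refine lintegral_congr_ae ?_
    filter_upwards [hlim] with x hx
    exact ((ENNReal.continuous_ofReal.tendsto _).comp hx).liminf_eq.symm
  have h2 : liminf (fun k => ∫⁻ x, ENNReal.ofReal (f k x) ∂μ) atTop ≤ ENNReal.ofReal C := by
    have h3 : Tendsto (fun k => ENNReal.ofReal (c k)) atTop (𝓝 (ENNReal.ofReal C)) :=
      (ENNReal.continuous_ofReal.tendsto _).comp hcC
    rw [← h3.liminf_eq]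
    refine liminf_le_liminf (Eventually.of_forall fun k => ?_)
    rw [← ofReal_integral_eq_lintegral_ofReal (hf k) (Eventually.of_forall (hf0 k))]
    exact ENNReal.ofReal_le_ofReal (hc k)
  rw [← ofReal_integral_eq_lintegral_ofReal hF hF0] at h1
  exact (ENNReal.ofReal_le_ofReal_iff hC).1 (h1.trans h2)

/-- A strictly positive barrier for the adjoint operator on a ball. -/
theorem exists_adjoint_barrier {n : ℕ} (hn : 3 ≤ n) (R K : ℝ) (hK : 0 ≤ K) :
    ∃ (v : Euc n → ℝ) (C : ℝ), ContDiff ℝ (⊤ : ℕ∞) v ∧ (∀ x ∈ ball (0 : Euc n) R, 0 < v x) ∧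
      (∀ x, v x ≤ C) ∧ (∀ x, 0 < -lap v x) ∧
      (∀ x b : Euc n, ‖b‖ ≤ K → fderiv ℝ v x b < -lap v x) := by
  let i₀ : Fin n := ⟨0, by omega⟩
  set α : ℝ := K + 1 with hα
  have hαp : 0 < α := by positivity
  have hcoord : ∀ x : Euc n, |x i₀| ≤ ‖x‖ := fun x => by
    simpa using PiLp.norm_apply_le x i₀
  have hE : ∀ x : Euc n, HasFDerivAt (fun y : Euc n => Real.exp (α * y i₀))
      (Real.exp (α * x i₀) • (α • EuclideanSpace.proj (𝕜 := ℝ) i₀)) x := fun x => by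
    have h1 : HasFDerivAt (fun y : Euc n => α * y i₀) (α • EuclideanSpace.proj (𝕜 := ℝ) i₀) x :=
      ((EuclideanSpace.proj (𝕜 := ℝ) i₀ : Euc n →L[ℝ] ℝ).hasFDerivAt).const_mul α
    exact h1.exp
  set v : Euc n → ℝ := fun x => Real.exp (α * R) - Real.exp (α * x i₀) with hv
  have hvd : ∀ x e : Euc n, fderiv ℝ v x e = -α * e i₀ * Real.exp (α * x i₀) := fun x e => by
    have : HasFDerivAt v _ x := (hE x).const_sub _
    rw [this.fderiv]
    simp
    ring
  have hlap : ∀ x, lap v x = -(α ^ 2 * Real.exp (α * x i₀)) := fun x => by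
    rw [lap, Finset.sum_eq_single i₀]
    · simp_rw [hvd]
      rw [((hE x).const_mul _).fderiv]
      simp
      ring
    · intro i _ hi
      simp_rw [hvd]
      simp [hi.symm]
    · simp
  refine ⟨v, Real.exp (α * R), ?_, ?_, ?_, ?_, ?_⟩
  · have : ContDiff ℝ (⊤ : ℕ∞) fun x : Euc n => x i₀ :=
      (EuclideanSpace.proj (𝕜 := ℝ) i₀ : Euc n →L[ℝ] ℝ).contDiff
    exact contDiff_const.sub (contDiff_const.mul this).exp
  · intro x hx
    rw [mem_ball_zero_iff] at hx
    have : x i₀ < R := (le_abs_self _).trans_lt ((hcoord x).trans_lt hx)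
    simp only [hv, sub_pos, Real.exp_lt_exp]
    gcongr
  · intro x
    simp only [hv]
    linarith [Real.exp_pos (α * x i₀)]
  · intro x
    rw [hlap]
    have := Real.exp_pos (α * x i₀)
    simp only [neg_neg]
    positivity
  · intro x b hb
    rw [hlap, hvd, neg_neg, pow_two]
    have hb' : -b i₀ ≤ K := (neg_le_abs _).trans ((hcoord b).trans hb)
    have := Real.exp_pos (α * x i₀)
    have h2 : α * (-b i₀) * Real.exp (α * x i₀) < α * α * Real.exp (α * x i₀) := by
      gcongr
      linarith
    linarith

theorem integral_conv_mul_comm {n : ℕ} {ρ F ψ : Euc n → ℝ} (hρ : Integrable ρ)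
    (hsym : ∀ x, ρ (-x) = ρ x) (hF : Integrable F) (hψ : Continuous ψ) {C : ℝ}
    (hC : ∀ x, ‖ψ x‖ ≤ C) :
    ∫ x, ψ x * conv ρ F x = ∫ x, F x * conv ρ ψ x := by
  simp_rw [conv_apply, ← integral_const_mul]
  rw [integral_integral_swap]
  · refine integral_congr_ae (Eventually.of_forall fun x => ?_)
    refine integral_congr_ae (Eventually.of_forall fun y => ?_)
    simp only
    rw [← hsym (y - x), neg_sub]
    ring
  · have h1 := hF.convolution_integrand (ContinuousLinearMap.lsmul ℝ ℝ) hρ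
    have h2 := h1.bdd_mul (c := C) (f := fun p : Euc n × Euc n => ψ p.1)
      (hψ.comp continuous_fst).aestronglyMeasurable (Eventually.of_forall fun p => hC p.1)
    refine h2.congr (Eventually.of_forall fun p => ?_)
    simp only [Function.uncurry, ContinuousLinearMap.lsmul_apply, smul_eq_mul]
    ring

theorem fderiv_coord {n : ℕ} {B : Euc n → Euc n} {x : Euc n} (hB : DifferentiableAt ℝ B x)
    (i : Fin n) (e : Euc n) : fderiv ℝ (fun y => B y i) x e = (fderiv ℝ B x e) i := by
  have h := ((EuclideanSpace.proj (𝕜 := ℝ) i : Euc n →L[ℝ] ℝ).hasFDerivAt).comp x hB.hasFDerivAt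
  have h' : fderiv ℝ (fun y => B y i) x = _ := h.fderiv
  rw [h']
  rfl

theorem divg_eq {n : ℕ} (B : Euc n → Euc n) (x : Euc n) :
    divg B x = ∑ i : Fin n, (fderiv ℝ B x (EuclideanSpace.single i 1)) i := by
  simp [divg, EuclideanSpace.inner_single_right]

theorem clm_apply_eq_sum {n : ℕ} (l : Euc n →L[ℝ] ℝ) (b : Euc n) :
    l b = ∑ i : Fin n, l (EuclideanSpace.single i 1) * b i := by
  conv_lhs => rw [← (EuclideanSpace.basisFun (Fin n) ℝ).sum_repr b]
  simp [mul_comm]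

/-- Integration by parts against a `C¹` vector field for a `W^{1,1}` function which is
differentiable away from the origin. -/
theorem integral_fderiv_apply_mul_eq {n : ℕ} (hn : 3 ≤ n) {p : Euc n → ℝ}
    (hd : ∀ x ≠ 0, DifferentiableAt ℝ p x) (hp : Integrable p) (hdp : Integrable (fderiv ℝ p))
    {B : Euc n → Euc n} (hB : ContDiff ℝ 1 B) (hBc : HasCompactSupport B)
    {v : Euc n → ℝ} (hv : ContDiff ℝ 1 v) :
    Integrable (fun x => p x * (divg B x * v x + fderiv ℝ v x (B x))) ∧
    ∫ x, fderiv ℝ p x (B x) * v x = -∫ x, p x * (divg B x * v x + fderiv ℝ v x (B x)) := by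
  have hBi : ∀ i : Fin n, ContDiff ℝ 1 fun x => B x i := fun i =>
    (EuclideanSpace.proj (𝕜 := ℝ) i : Euc n →L[ℝ] ℝ).contDiff.comp hB
  have hq : ∀ i : Fin n, ContDiff ℝ 1 fun x => B x i * v x := fun i => (hBi i).mul hv
  have hqc : ∀ i : Fin n, HasCompactSupport fun x => B x i * v x := fun i => by
    have : HasCompactSupport fun x => B x i :=
      hBc.comp_left (g := fun b : Euc n => b i) (by simp)
    exact this.mul_right
  have hinteg : ∀ i : Fin n, Integrable fun x => p x *
      fderiv ℝ (fun x => B x i * v x) x (EuclideanSpace.single i 1) := fun i => by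
    have hcont := ((hq i).continuous_fderiv (by simp)).clm_apply
      (continuous_const (y := EuclideanSpace.single i (1 : ℝ)))
    obtain ⟨C, hC⟩ := ((hqc i).fderiv_apply ℝ (EuclideanSpace.single i 1)).exists_bound_of_continuous
      hcont
    exact hp.mul_bdd hcont.aestronglyMeasurable (Eventually.of_forall hC)
  have hsum : ∀ x, p x * (divg B x * v x + fderiv ℝ v x (B x)) = ∑ i : Fin n, p x *
      fderiv ℝ (fun x => B x i * v x) x (EuclideanSpace.single i 1) := fun x => by
    rw [divg_eq, clm_apply_eq_sum, ← Finset.mul_sum, Finset.sum_mul, ← Finset.sum_add_distrib]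
    congr 1
    refine Finset.sum_congr rfl fun i _ => ?_
    have h1 := ((hBi i).differentiable (by simp) x).hasFDerivAt.mul
      (hv.differentiable (by simp) x).hasFDerivAt
    have h2 : fderiv ℝ (fun x => B x i * v x) x = _ := h1.fderiv
    rw [h2]
    simp [fderiv_coord (hB.differentiable (by simp) x)]
    ring
  simp_rw [hsum]
  refine ⟨integrable_finsetSum _ fun i _ => hinteg i, ?_⟩
  rw [integral_finsetSum _ fun i _ => hinteg i, ← Finset.sum_neg_distrib]
  have hinteg' : ∀ i : Fin n, Integrable fun x =>
      fderiv ℝ p x (EuclideanSpace.single i 1) * (B x i * v x) := fun i => by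
    obtain ⟨C, hC⟩ := (hqc i).exists_bound_of_continuous (hq i).continuous
    exact (hdp.apply_continuousLinearMap _).mul_bdd (hq i).continuous.aestronglyMeasurable
      (Eventually.of_forall hC)
  have : ∀ x, fderiv ℝ p x (B x) * v x =
      ∑ i : Fin n, fderiv ℝ p x (EuclideanSpace.single i 1) * (B x i * v x) := fun x => by
    rw [clm_apply_eq_sum, Finset.sum_mul]
    exact Finset.sum_congr rfl fun i _ => by ring
  simp_rw [this]
  rw [integral_finsetSum _ fun i _ => hinteg' i]
  refine Finset.sum_congr rfl fun i _ => ?_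
  exact integral_fderiv_mul_eq_of_differentiableAt_ne_zero hn hd hp hdp (hq i) (hqc i) _

/-- A sequence of bump functions at the origin with outer radius `d / (k + 1)`. -/
def bumpSeq (n : ℕ) {d : ℝ} (hd : 0 < d) (k : ℕ) : ContDiffBump (0 : Euc n) where
  rIn := d / (k + 1) / 2
  rOut := d / (k + 1)
  rIn_pos := by positivity
  rIn_lt_rOut := half_lt_self (by positivity)

/-- The normalized bump functions `bumpSeq`. -/
def mollifier (n : ℕ) {d : ℝ} (hd : 0 < d) (k : ℕ) : Euc n → ℝ :=
  (bumpSeq n hd k).normed volume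

section Mollifier

variable {n : ℕ} {d : ℝ} (hd : 0 < d) (k : ℕ)

theorem contDiff_mollifier : ContDiff ℝ (⊤ : ℕ∞) (mollifier n hd k) :=
  (bumpSeq n hd k).contDiff_normed

theorem hasCompactSupport_mollifier : HasCompactSupport (mollifier n hd k) :=
  (bumpSeq n hd k).hasCompactSupport_normed

theorem mollifier_nonneg (x : Euc n) : 0 ≤ mollifier n hd k x :=
  (bumpSeq n hd k).nonneg_normed x

theorem mollifier_neg (x : Euc n) : mollifier n hd k (-x) = mollifier n hd k x :=
  (bumpSeq n hd k).normed_neg x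

theorem integrable_mollifier : Integrable (mollifier n hd k) :=
  (bumpSeq n hd k).integrable_normed

theorem integral_mollifier : ∫ x, mollifier n hd k x = 1 :=
  (bumpSeq n hd k).integral_normed

theorem tsupport_mollifier : tsupport (mollifier n hd k) = closedBall 0 (d / (k + 1)) :=
  (bumpSeq n hd k).tsupport_normed_eq

theorem integral_mollifier_sub (x : Euc n) : ∫ y, mollifier n hd k (x - y) = 1 := by
  rw [integral_sub_left_eq_self (mollifier n hd k) volume x, integral_mollifier]

theorem integrable_mollifier_sub_mul {U : Euc n → ℝ} (hU : Integrable U) (x : Euc n) :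
    Integrable fun y => mollifier n hd k (x - y) * U y := by
  obtain ⟨C, hC⟩ := (hasCompactSupport_mollifier hd k).exists_bound_of_continuous
    (contDiff_mollifier hd k).continuous
  exact hU.bdd_mul ((contDiff_mollifier hd k).continuous.comp
    (continuous_const.sub continuous_id)).aestronglyMeasurable
    (Eventually.of_forall fun y => hC (x - y))

theorem conv_mollifier_le {U : Euc n → ℝ} (hU : Integrable U) {x : Euc n} {c : ℝ}
    (h : ∀ y ∈ closedBall x (d / (k + 1)), U y ≤ c) : conv (mollifier n hd k) U x ≤ c := by
  rw [conv_apply]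
  have hi : Integrable fun y => mollifier n hd k (x - y) * c :=
    ((integrable_mollifier hd k).comp_sub_left x).mul_const c
  calc _ ≤ ∫ y, mollifier n hd k (x - y) * c := by
        refine integral_mono (integrable_mollifier_sub_mul hd k hU x) hi fun y => ?_
        by_cases hy : y ∈ closedBall x (d / (k + 1))
        · exact mul_le_mul_of_nonneg_left (h y hy) (mollifier_nonneg hd k _)
        · have : mollifier n hd k (x - y) = 0 := by
            refine image_eq_zero_of_notMem_tsupport fun h => hy ?_
            rw [tsupport_mollifier, mem_closedBall_zero_iff] at h
            rwa [mem_closedBall, dist_eq_norm, norm_sub_rev]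
          simp [this]
    _ = c := by rw [integral_mul_const, integral_mollifier_sub, one_mul]

theorem norm_conv_mollifier_le {ψ : Euc n → ℝ} {C : ℝ} (hC : ∀ x, ‖ψ x‖ ≤ C) (x : Euc n) :
    ‖conv (mollifier n hd k) ψ x‖ ≤ C := by
  rw [conv_apply]
  have hi : Integrable fun y => mollifier n hd k (x - y) * C :=
    ((integrable_mollifier hd k).comp_sub_left x).mul_const C
  refine (norm_integral_le_of_norm_le hi (Eventually.of_forall fun y => ?_)).trans_eq ?_
  · rw [norm_mul, Real.norm_of_nonneg (mollifier_nonneg hd k _)]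
    exact mul_le_mul_of_nonneg_left (hC y) (mollifier_nonneg hd k _)
  · rw [integral_mul_const, integral_mollifier_sub, one_mul]

theorem tendsto_bumpSeq_rOut : Tendsto (fun k => (bumpSeq n hd k).rOut) atTop (𝓝 0) := by
  change Tendsto (fun k : ℕ => d / ((k : ℝ) + 1)) atTop (𝓝 0)
  exact (tendsto_atTop_add_const_right _ _ tendsto_natCast_atTop_atTop).const_div_atTop d

theorem tendsto_conv_mollifier {ι : Type*} {l : Filter ι} {κ : ι → ℕ} (hκ : Tendsto κ l atTop)
    {g : ι → Euc n → ℝ} {y : ι → Euc n} {x₀ : Euc n} {z₀ : ℝ}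
    (hg : ∀ i, AEStronglyMeasurable (g i) volume)
    (hcg : Tendsto (Function.uncurry g) (l ×ˢ 𝓝 x₀) (𝓝 z₀)) (hy : Tendsto y l (𝓝 x₀)) :
    Tendsto (fun i => conv (mollifier n hd (κ i)) (g i) (y i)) l (𝓝 z₀) :=
  ContDiffBump.convolution_tendsto_right ((tendsto_bumpSeq_rOut hd).comp hκ)
    (Eventually.of_forall hg) hcg hy

end Mollifier

theorem integrable_fderiv_apply {n : ℕ} {K : ℝ} {B : Euc n → Euc n} (hB : Continuous B)
    (hK : ∀ x, ‖B x‖ ≤ K) {U : Euc n → ℝ} (hdU : Integrable (fderiv ℝ U)) :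
    Integrable fun x => fderiv ℝ U x (B x) := by
  refine (hdU.norm.mul_const K).mono' ?_ (Eventually.of_forall fun x => ?_)
  · have : (fun x => fderiv ℝ U x (B x)) = fun x => ∑ i : Fin n, fderiv ℝ U x (EuclideanSpace.single i 1) * B x i :=
      funext fun x => clm_apply_eq_sum _ _
    rw [this]
    refine (Finset.measurable_sum _ fun i _ => ?_).aestronglyMeasurable
    exact (measurable_fderiv_apply_const ℝ U _).mul
      ((EuclideanSpace.proj (𝕜 := ℝ) i).continuous.comp hB).measurable
  · exact (fderiv ℝ U x).le_opNorm_of_le (hK x)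

theorem conv_mollifier_le_of_norm_ge {n : ℕ} {d R R' ε : ℝ} (hd : 0 < d) (hdR : R + 2 * d ≤ R')
    {U : Euc n → ℝ} (hU : Integrable U) (hUε : ∀ x, R ≤ ‖x‖ → U x ≤ ε) (k : ℕ) (x : Euc n)
    (hx : R' - d / ((k : ℝ) + 1) ≤ ‖x‖) : conv (mollifier n hd k) U x ≤ ε := by
  have hdk : d / ((k : ℝ) + 1) ≤ d :=
    div_le_self hd.le (by linarith [(Nat.cast_nonneg k : (0 : ℝ) ≤ k)])
  refine conv_mollifier_le hd k hU fun y hy => hUε y ?_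
  rw [mem_closedBall, dist_comm, dist_eq_norm] at hy
  have := norm_sub_norm_le x y
  linarith

theorem conv_mollifier_le_lap {n : ℕ} (hn : 3 ≤ n) {d R' : ℝ} (hdp : 0 < d)
    {B : Euc n → Euc n} {U : Euc n → ℝ} (hd : ∀ x ≠ 0, DifferentiableAt ℝ U x)
    (hU : Integrable U) (hdU : Integrable (fderiv ℝ U))
    (hFi : Integrable fun x => fderiv ℝ U x (B x))
    (hweak : ∀ φ : Euc n → ℝ, ContDiff ℝ (⊤ : ℕ∞) φ → HasCompactSupport φ →
      tsupport φ ⊆ ball 0 R' → (∀ x, 0 ≤ φ x) →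
      ∫ x, ((∑ i : Fin n, fderiv ℝ U x (EuclideanSpace.single i 1) *
        fderiv ℝ φ x (EuclideanSpace.single i 1)) + fderiv ℝ U x (B x) * φ x) ≤ 0)
    (k : ℕ) (x : Euc n) (hx : ‖x‖ < R' - d / ((k : ℝ) + 1)) :
    conv (mollifier n hdp k) (fun x => fderiv ℝ U x (B x)) x ≤
      lap (conv (mollifier n hdp k) U) x := by
  have hρ := contDiff_mollifier (n := n) hdp k
  have hρc := hasCompactSupport_mollifier (n := n) hdp k
  have hφ : ContDiff ℝ (⊤ : ℕ∞) fun z => mollifier n hdp k (x - z) :=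
    hρ.comp (contDiff_const.sub contDiff_id)
  have hφc := hasCompactSupport_comp_sub hρc x
  have hw := hweak (fun z => mollifier n hdp k (x - z)) hφ hφc ?_
    fun z => mollifier_nonneg hdp k _
  · rw [integral_add] at hw
    · rw [lap_conv_eq hn hρ hρc hd hU hdU, conv_apply]
      have : ∫ y, mollifier n hdp k (x - y) * fderiv ℝ U y (B y) =
          ∫ y, fderiv ℝ U y (B y) * mollifier n hdp k (x - y) :=
        integral_congr_ae (Eventually.of_forall fun y => mul_comm _ _)
      linarith
    · refine integrable_finsetSum _ fun i _ => ?_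
      obtain ⟨C, hC⟩ := (hφc.fderiv_apply ℝ
        (EuclideanSpace.single i 1)).exists_bound_of_continuous
        (contDiff_fderiv_apply hφ _).continuous
      exact (hdU.apply_continuousLinearMap _).mul_bdd
        (contDiff_fderiv_apply hφ _).continuous.aestronglyMeasurable (Eventually.of_forall hC)
    · exact (integrable_mollifier_sub_mul hdp k hFi x).congr
        (Eventually.of_forall fun y => mul_comm _ _)
  · have hs : tsupport (fun z => mollifier n hdp k (x - z)) ⊆
        closedBall x (d / ((k : ℝ) + 1)) := by
      refine closure_minimal (fun z hz => ?_) isClosed_closedBall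
      have := subset_tsupport _ (show x - z ∈ Function.support (mollifier n hdp k) from hz)
      rw [tsupport_mollifier, mem_closedBall_zero_iff] at this
      rwa [mem_closedBall, dist_eq_norm, norm_sub_rev]
    refine hs.trans fun z hz => ?_
    rw [mem_closedBall, dist_eq_norm] at hz
    rw [mem_ball_zero_iff]
    have := norm_sub_norm_le z x
    linarith

/-- The regularized form of Kato's inequality, tested against the adjoint barrier `v`. -/
theorem integral_comp_conv_mollifier_mul_lap_le {n : ℕ} {d R' ε Cv : ℝ} (hdp : 0 < d)
    {H h h' : ℝ → ℝ} (hH : ∀ s, HasDerivAt H (h s) s) (hh : ∀ s, HasDerivAt h (h' s) s)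
    (hHs : ContDiff ℝ (⊤ : ℕ∞) H) (h'0 : ∀ s, 0 ≤ h' s) (h0 : ∀ s, 0 ≤ h s)
    (hHε : ∀ s ≤ ε, H s = 0 ∧ h s = 0 ∧ h' s = 0) {v : Euc n → ℝ}
    (hv : ContDiff ℝ (⊤ : ℕ∞) v) (hvpos : ∀ x ∈ ball (0 : Euc n) R', 0 < v x)
    {F V : Euc n → ℝ} (hFi : Integrable F) (hVs : ContDiff ℝ (⊤ : ℕ∞) V) (k : ℕ)
    (hVε : ∀ x, R' - d / ((k : ℝ) + 1) ≤ ‖x‖ → V x ≤ ε)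
    (hVlap : ∀ x, ‖x‖ < R' - d / ((k : ℝ) + 1) → conv (mollifier n hdp k) F x ≤ lap V x)
    (hψb : ∀ x, ‖h (V x) * v x‖ ≤ Cv) :
    ∫ x, H (V x) * -lap v x ≤
      -∫ x, F x * conv (mollifier n hdp k) (fun x => h (V x) * v x) x := by
  have hhc : Continuous h := continuous_iff_continuousAt.2 fun s => (hh s).continuousAt
  have hdk : 0 < d / ((k : ℝ) + 1) := by positivity
  have hψc : Continuous fun x => h (V x) * v x := (hhc.comp hVs.continuous).mul hv.continuous
  have hineq : ∀ x, (h (V x) * v x) * conv (mollifier n hdp k) F x ≤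
      lap (fun y => H (V y)) x * v x := by
    intro x
    rw [lap_comp hH hh hVs]
    by_cases hx : ‖x‖ < R' - d / ((k : ℝ) + 1)
    · have hvx : 0 < v x := hvpos x (mem_ball_zero_iff.2 (by linarith))
      have h3 : h (V x) * conv (mollifier n hdp k) F x ≤ h (V x) * lap V x +
          h' (V x) * ∑ i : Fin n, (fderiv ℝ V x (EuclideanSpace.single i 1)) ^ 2 := by
        have h4 : 0 ≤ h' (V x) *
            ∑ i : Fin n, (fderiv ℝ V x (EuclideanSpace.single i 1)) ^ 2 :=
          mul_nonneg (h'0 _) (Finset.sum_nonneg fun i _ => sq_nonneg _)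
        have := mul_le_mul_of_nonneg_left (hVlap x hx) (h0 (V x))
        linarith
      calc _ = (h (V x) * conv (mollifier n hdp k) F x) * v x := by ring
        _ ≤ _ := mul_le_mul_of_nonneg_right h3 hvx.le
    · obtain ⟨_, e1, e2⟩ := hHε _ (hVε x (not_lt.1 hx))
      simp [e1, e2]
  have hpc : HasCompactSupport fun y => H (V y) := by
    refine HasCompactSupport.of_support_subset_isCompact (isCompact_closedBall 0 R') fun x hx => ?_
    by_contra hx'
    rw [mem_closedBall_zero_iff, not_le] at hx'
    exact hx (hHε _ (hVε x (by linarith))).1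
  have hps : ContDiff ℝ (⊤ : ℕ∞) fun y => H (V y) := hHs.comp hVs
  have hlappc : Continuous (lap fun y => H (V y)) :=
    continuous_finsetSum _ fun i _ =>
      (contDiff_fderiv_apply (contDiff_fderiv_apply hps _) _).continuous
  have hlaps : HasCompactSupport (lap fun y => H (V y)) := by
    refine HasCompactSupport.of_support_subset_isCompact hpc fun x hx => ?_
    by_contra hx'
    refine hx (Finset.sum_eq_zero fun i _ => ?_)
    refine image_eq_zero_of_notMem_tsupport
      (f := fun x => fderiv ℝ (fun y => fderiv ℝ (fun y => H (V y)) y (EuclideanSpace.single i 1)) x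
        (EuclideanSpace.single i 1)) fun hmem => hx' ?_
    exact tsupport_fderiv_apply_subset ℝ _ (tsupport_fderiv_apply_subset ℝ _ hmem)
  simp_rw [mul_neg]
  rw [integral_neg, integral_mul_lap_comm hps hpc hv,
    ← integral_conv_mul_comm (integrable_mollifier hdp k) (mollifier_neg hdp k) hFi hψc hψb]
  refine neg_le_neg (integral_mono ?_ ?_ hineq)
  · have : Integrable (conv (mollifier n hdp k) F) :=
      (integrable_mollifier hdp k).integrable_convolution _ hFi
    exact this.bdd_mul hψc.aestronglyMeasurable (Eventually.of_forall hψb)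
  · exact (hlappc.mul hv.continuous).integrable_of_hasCompactSupport hlaps.mul_right

/-- Kato's inequality for weak subsolutions, tested against the adjoint barrier `v`. -/
theorem integral_comp_mul_lap_le {n : ℕ} (hn : 3 ≤ n) {R R' ε Cv : ℝ} (hRR' : R < R')
    (hR : 0 < R) {H h h' : ℝ → ℝ} (hH : ∀ s, HasDerivAt H (h s) s)
    (hh : ∀ s, HasDerivAt h (h' s) s)
    (hHs : ContDiff ℝ (⊤ : ℕ∞) H) (h'0 : ∀ s, 0 ≤ h' s) (h0 : ∀ s, 0 ≤ h s) (h1 : ∀ s, h s ≤ 1)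
    (hHε : ∀ s ≤ ε, H s = 0 ∧ h s = 0 ∧ h' s = 0) (hHnn : ∀ s, 0 ≤ H s) {v : Euc n → ℝ}
    (hv : ContDiff ℝ (⊤ : ℕ∞) v) (hvpos : ∀ x ∈ ball (0 : Euc n) R', 0 < v x)
    (hvC : ∀ x, v x ≤ Cv) (hlapv : ∀ x, 0 < -lap v x) (hlapvc : Continuous (lap v))
    {B : Euc n → Euc n}
    {U : Euc n → ℝ} (hd : ∀ x ≠ 0, DifferentiableAt ℝ U x) (hU : Integrable U)
    (hdU : Integrable (fderiv ℝ U)) (hFi : Integrable fun x => fderiv ℝ U x (B x))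
    (hUε : ∀ x, R ≤ ‖x‖ → U x ≤ ε)
    (hweak : ∀ φ : Euc n → ℝ, ContDiff ℝ (⊤ : ℕ∞) φ → HasCompactSupport φ →
      tsupport φ ⊆ ball 0 R' → (∀ x, 0 ≤ φ x) →
      ∫ x, ((∑ i : Fin n, fderiv ℝ U x (EuclideanSpace.single i 1) *
        fderiv ℝ φ x (EuclideanSpace.single i 1)) + fderiv ℝ U x (B x) * φ x) ≤ 0)
    (hpl : Integrable fun x => H (U x) * -lap v x) :
    ∫ x, H (U x) * -lap v x ≤ -∫ x, fderiv ℝ U x (B x) * (h (U x) * v x) := by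
  have hne := Euc.ae_ne_zero hn
  have hhc : Continuous h := continuous_iff_continuousAt.2 fun s => (hh s).continuousAt
  have hHc : Continuous H := hHs.continuous
  have hUm : Measurable U := measurable_of_differentiableAt_ne_zero hd
  obtain ⟨d, hdp, hdR⟩ : ∃ d : ℝ, 0 < d ∧ R + 2 * d ≤ R' :=
    ⟨(R' - R) / 2, by linarith, by linarith⟩
  obtain ⟨F, hF⟩ : ∃ F : Euc n → ℝ, F = fun x => fderiv ℝ U x (B x) := ⟨_, rfl⟩
  have hFe : ∀ x, fderiv ℝ U x (B x) = F x := fun x => by rw [hF]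
  obtain ⟨V, hV⟩ : ∃ V : ℕ → Euc n → ℝ, V = fun k => conv (mollifier n hdp k) U := ⟨_, rfl⟩
  have hVs : ∀ k, ContDiff ℝ (⊤ : ℕ∞) (V k) := fun k => by
    rw [hV]
    exact contDiff_conv (contDiff_mollifier hdp k) (hasCompactSupport_mollifier hdp k) hU
  have hVε : ∀ (k : ℕ) x, R' - d / ((k : ℝ) + 1) ≤ ‖x‖ → V k x ≤ ε := fun k x hx => by
    rw [hV]
    exact conv_mollifier_le_of_norm_ge hdp hdR hU hUε k x hx
  have hVlap : ∀ (k : ℕ) x, ‖x‖ < R' - d / ((k : ℝ) + 1) →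
      conv (mollifier n hdp k) F x ≤ lap (V k) x := fun k x hx => by
    rw [hV, hF]
    exact conv_mollifier_le_lap hn hdp hd hU hdU hFi hweak k x hx
  rw [← hF] at hFi
  simp_rw [hFe]
  have hψb : ∀ k x, ‖h (V k x) * v x‖ ≤ Cv := by
    intro k x
    by_cases hx : ‖x‖ < R'
    · have hvx := hvpos x (mem_ball_zero_iff.2 hx)
      rw [Real.norm_of_nonneg (mul_nonneg (h0 _) hvx.le)]
      calc _ ≤ 1 * v x := by gcongr; exact h1 _
        _ ≤ Cv := by rw [one_mul]; exact hvC x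
    · have : 0 < d / ((k : ℝ) + 1) := by positivity
      rw [(hHε _ (hVε k x (by linarith))).2.1]
      simp only [zero_mul, norm_zero]
      exact (hvpos 0 (mem_ball_self (hR.trans hRR'))).le.trans (hvC 0)
  have hψc : ∀ k, Continuous fun x => h (V k x) * v x := fun k =>
    (hhc.comp (hVs k).continuous).mul hv.continuous
  have hc := fun k => integral_comp_conv_mollifier_mul_lap_le hdp hH hh hHs h'0 h0 hHε hv hvpos
    hFi (hVs k) k (hVε k) (hVlap k) (hψb k)
  have hVlim : ∀ x ≠ 0, Tendsto (Function.uncurry V) (atTop ×ˢ 𝓝 x) (𝓝 (U x)) := by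
    intro x hx
    rw [hV]
    refine tendsto_conv_mollifier hdp (κ := Prod.fst) (l := atTop ×ˢ 𝓝 x) tendsto_fst
      (g := fun _ => U) (y := Prod.snd) (fun _ => hUm.aestronglyMeasurable) ?_ tendsto_snd
    exact (hd x hx).continuousAt.tendsto.comp tendsto_snd
  have hVlim' : ∀ x ≠ 0, Tendsto (fun k => V k x) atTop (𝓝 (U x)) := fun x hx =>
    (hVlim x hx).comp (tendsto_id.prodMk tendsto_const_nhds)
  have hlimc : Tendsto (fun k => -∫ x, F x * conv (mollifier n hdp k) (fun x => h (V k x) * v x) x) atTop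
      (𝓝 (-∫ x, F x * (h (U x) * v x))) := by
    refine Tendsto.neg (tendsto_integral_of_dominated_convergence (fun x => ‖F x‖ * Cv) ?_
      (hFi.norm.mul_const _) ?_ ?_)
    · intro k
      refine hFi.aestronglyMeasurable.mul ?_
      refine (Continuous.aestronglyMeasurable ?_)
      exact (hasCompactSupport_mollifier hdp k).continuous_convolution_left _
        (contDiff_mollifier hdp k).continuous (hψc k).locallyIntegrable
    · intro k
      refine Eventually.of_forall fun x => ?_
      rw [norm_mul]
      exact mul_le_mul_of_nonneg_left (norm_conv_mollifier_le hdp k (hψb k) x) (norm_nonneg _)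
    · filter_upwards [hne] with x hx
      refine Tendsto.const_mul _ ?_
      refine tendsto_conv_mollifier hdp tendsto_id (fun k => (hψc k).aestronglyMeasurable) ?_
        (tendsto_const_nhds (x := x))
      exact ((hhc.tendsto _).comp (hVlim x hx)).mul
        ((hv.continuous.tendsto x).comp tendsto_snd)
  refine integral_le_of_tendsto_of_integral_le (f := fun k x => H (V k x) * -lap v x) ?_
    (fun k x => mul_nonneg (hHnn _) (hlapv x).le) hpl ?_ hc hlimc
  · intro k
    refine ((hHc.comp (hVs k).continuous).mul hlapvc.neg).integrable_of_hasCompactSupport ?_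
    refine HasCompactSupport.of_support_subset_isCompact (isCompact_closedBall 0 R') fun x hx => ?_
    by_contra hx'
    rw [mem_closedBall_zero_iff, not_le] at hx'
    have : 0 < d / ((k : ℝ) + 1) := by positivity
    exact hx (by simp [(hHε _ (hVε k x (by linarith))).1])
  · filter_upwards [hne] with x hx
    exact ((hHc.tendsto _).comp (hVlim' x hx)).mul_const _

/-- Weak maximum principle for `W^{1,1}` subsolutions which are differentiable away from the
origin. -/
theorem le_of_weak_subsolution {n : ℕ} (hn : 3 ≤ n) {R R' ε K : ℝ} (hRR' : R < R') (hR : 0 < R)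
    (hε : 0 ≤ ε) {B : Euc n → Euc n} (hB : ContDiff ℝ 1 B) (hBc : HasCompactSupport B)
    (hK : ∀ x, ‖B x‖ ≤ K) (hdiv : ∀ x ∈ ball (0 : Euc n) R', divg B x ≤ 0)
    {U : Euc n → ℝ} (hd : ∀ x ≠ 0, DifferentiableAt ℝ U x) (hU : Integrable U)
    (hdU : Integrable (fderiv ℝ U)) (hUε : ∀ x, R ≤ ‖x‖ → U x ≤ ε)
    (hweak : ∀ φ : Euc n → ℝ, ContDiff ℝ (⊤ : ℕ∞) φ → HasCompactSupport φ →
      tsupport φ ⊆ ball 0 R' → (∀ x, 0 ≤ φ x) →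
      ∫ x, ((∑ i : Fin n, fderiv ℝ U x (EuclideanSpace.single i 1) *
        fderiv ℝ φ x (EuclideanSpace.single i 1)) + fderiv ℝ U x (B x) * φ x) ≤ 0) :
    ∀ x ≠ 0, U x ≤ ε := by
  have hne := Euc.ae_ne_zero hn
  have hK0 : 0 ≤ K := (norm_nonneg _).trans (hK 0)
  obtain ⟨H, h, h', hH, hh, hHs, h'0, h0, h1, hHε, hHpos, hHnn, hHle⟩ :=
    exists_smooth_convex_cutoff hε
  obtain ⟨v, Cv, hv, hvpos, hvC, hlapv, hvB⟩ := exists_adjoint_barrier hn R' K hK0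
  have hhc : Continuous h := continuous_iff_continuousAt.2 fun s => (hh s).continuousAt
  have hUm : Measurable U := measurable_of_differentiableAt_ne_zero hd
  have hFi : Integrable fun x => fderiv ℝ U x (B x) :=
    integrable_fderiv_apply hB.continuous hK hdU
  have hlapvc : Continuous (lap v) := continuous_finsetSum _ fun i _ =>
    (contDiff_fderiv_apply (contDiff_fderiv_apply hv _) _).continuous
  set p : Euc n → ℝ := fun x => H (U x) with hp
  have hHc : Continuous H := hHs.continuous
  have hpm : Measurable p := hHc.measurable.comp hUm
  have hpi : Integrable p := hU.abs.mono' hpm.aestronglyMeasurable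
    (Eventually.of_forall fun x => by rw [Real.norm_of_nonneg (hHnn _)]; exact hHle _)
  have hp0 : ∀ x, R ≤ ‖x‖ → p x = 0 := fun x hx => (hHε _ (hUε x hx)).1
  obtain ⟨C1, hC1⟩ := (isCompact_closedBall (0 : Euc n) R).exists_bound_of_continuousOn
    hlapvc.continuousOn
  have hpl : Integrable fun x => p x * -lap v x := by
    refine (hpi.norm.mul_const C1).mono' (hpm.mul hlapvc.measurable.neg).aestronglyMeasurable
      (Eventually.of_forall fun x => ?_)
    by_cases hx : ‖x‖ ≤ R
    · rw [norm_mul, norm_neg]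
      gcongr
      exact hC1 x (mem_closedBall_zero_iff.2 hx)
    · rw [hp0 x (not_le.1 hx).le]
      simp
  have hmain : ∫ x, p x * -lap v x ≤ -∫ x, fderiv ℝ U x (B x) * (h (U x) * v x) :=
    integral_comp_mul_lap_le hn hRR' hR hH hh hHs h'0 h0 h1 hHε hHnn hv hvpos hvC hlapv hlapvc
      hd hU hdU hFi hUε hweak hpl
  have hpd : ∀ x ≠ 0, HasFDerivAt p (h (U x) • fderiv ℝ U x) x := fun x hx =>
    (hH (U x)).comp_hasFDerivAt x (hd x hx).hasFDerivAt
  have hdp' : Integrable (fderiv ℝ p) := by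
    refine hdU.norm.mono' (measurable_fderiv ℝ p).aestronglyMeasurable ?_
    filter_upwards [hne] with x hx
    rw [(hpd x hx).fderiv, norm_smul, Real.norm_of_nonneg (h0 _)]
    calc _ ≤ 1 * ‖fderiv ℝ U x‖ := by gcongr; exact h1 _
      _ = _ := one_mul _
  obtain ⟨hXi, hX⟩ := integral_fderiv_apply_mul_eq hn (fun x hx => (hpd x hx).differentiableAt)
    hpi hdp' hB hBc (hv.of_le (by exact_mod_cast le_top))
  have hFX : ∫ x, fderiv ℝ U x (B x) * (h (U x) * v x) = ∫ x, fderiv ℝ p x (B x) * v x := by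
    refine integral_congr_ae ?_
    filter_upwards [hne] with x hx
    rw [(hpd x hx).fderiv]
    simp
    ring
  rw [hFX, hX, neg_neg] at hmain
  have hnn : ∀ x, 0 ≤ p x * (-lap v x - (divg B x * v x + fderiv ℝ v x (B x))) ∧
      (0 < p x → 0 < p x * (-lap v x - (divg B x * v x + fderiv ℝ v x (B x)))) := by
    intro x
    by_cases hx : R ≤ ‖x‖
    · simp [hp0 x hx]
    · have hxb : x ∈ ball (0 : Euc n) R' := mem_ball_zero_iff.2 (by linarith)
      have e1 := hvB x (B x) (hK x)
      have e2 := mul_nonpos_of_nonpos_of_nonneg (hdiv x hxb) (hvpos x hxb).le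
      have e3 : 0 < -lap v x - (divg B x * v x + fderiv ℝ v x (B x)) := by linarith
      exact ⟨mul_nonneg (hHnn _) e3.le, fun hpx => mul_pos hpx e3⟩
  have hzero : (fun x => p x * (-lap v x - (divg B x * v x + fderiv ℝ v x (B x)))) =ᵐ[volume] 0 := by
    have hi : Integrable fun x => p x * (-lap v x - (divg B x * v x + fderiv ℝ v x (B x))) := by
      simp_rw [mul_sub]
      exact hpl.sub hXi
    rw [← integral_eq_zero_iff_of_nonneg (fun x => (hnn x).1) hi]
    refine le_antisymm ?_ (integral_nonneg fun x => (hnn x).1)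
    simp_rw [mul_sub]
    rw [integral_sub hpl hXi]
    linarith
  intro x hx
  by_contra hcon
  rw [not_le] at hcon
  have hev : ∀ᶠ y in 𝓝 x, 0 < p y := by
    filter_upwards [(hd x hx).continuousAt.tendsto.eventually (lt_mem_nhds hcon)] with y hy
    exact hHpos _ hy
  have hpos : volume {y | 0 < p y} ≠ 0 := by
    have := Measure.measure_pos_of_mem_nhds volume hev
    exact this.ne'
  refine hpos (measure_mono_null (fun y hy => ?_) (ae_iff.1 hzero))
  exact ((hnn y).2 hy).ne.symm

/-- Integration in polar coordinates. -/
theorem ae_integrableOn_and_integral_eq_polar {n : ℕ} (hn : 3 ≤ n) {G : Euc n → ℝ}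
    (hG : Integrable G) :
    (∀ᵐ θ : sphere (0 : Euc n) 1 ∂(volume : Measure (Euc n)).toSphere,
      IntegrableOn (fun r : ℝ => r ^ (n - 1) * G (r • (θ : Euc n))) (Ioi 0)) ∧
    ∫ x, G x = ∫ θ, (∫ r in Ioi (0 : ℝ), r ^ (n - 1) * G (r • (θ : Euc n)))
      ∂(volume : Measure (Euc n)).toSphere := by
  have := Euc.nontrivial hn
  have hmp := (volume : Measure (Euc n)).measurePreserving_homeomorphUnitSphereProd
  have hme := (homeomorphUnitSphereProd (Euc n)).measurableEmbedding
  have hfin : Module.finrank ℝ (Euc n) - 1 = n - 1 := by simp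
  rw [hfin] at hmp
  set P : sphere (0 : Euc n) 1 × Ioi (0 : ℝ) → ℝ := fun p => G ((p.2 : ℝ) • (p.1 : Euc n)) with hP
  have hPe : ∀ x : ({(0)}ᶜ : Set (Euc n)), P (homeomorphUnitSphereProd (Euc n) x) = G x := by
    intro x
    have h0 : ‖(x : Euc n)‖ ≠ 0 := norm_ne_zero_iff.2 x.2
    simp [hP, smul_smul, mul_inv_cancel₀ h0]
  have hPi : Integrable P ((volume : Measure (Euc n)).toSphere.prod
      (Measure.volumeIoiPow (n - 1))) := by
    rw [← hmp.integrable_comp_emb hme]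
    have h1 : IntegrableOn G ({(0)}ᶜ : Set (Euc n)) := hG.integrableOn
    rw [integrableOn_iff_comap_subtypeVal (measurableSet_singleton _).compl] at h1
    exact h1.congr (Eventually.of_forall fun x => (hPe x).symm)
  have hin : ∀ θ : sphere (0 : Euc n) 1,
      ∫ r, P (θ, r) ∂(Measure.volumeIoiPow (n - 1)) =
        ∫ r in Ioi (0 : ℝ), r ^ (n - 1) * G (r • (θ : Euc n)) := by
    intro θ
    simp only [Measure.volumeIoiPow, ENNReal.ofReal]
    rw [integral_withDensity_eq_integral_smul
      (measurable_subtype_coe.pow_const _).real_toNNReal,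
      integral_subtype_comap measurableSet_Ioi
        fun a : ℝ => Real.toNNReal (a ^ (n - 1)) • G (a • (θ : Euc n))]
    refine setIntegral_congr_fun measurableSet_Ioi fun x hx => ?_
    rw [NNReal.smul_def, Real.coe_toNNReal _ (pow_nonneg (le_of_lt hx) _), smul_eq_mul]
  constructor
  · filter_upwards [hPi.prod_right_ae] with θ hθ
    rw [integrableOn_iff_comap_subtypeVal measurableSet_Ioi]
    rw [Measure.volumeIoiPow, integrable_withDensity_iff_integrable_smul' (by fun_prop)
      (by simp)] at hθ
    refine hθ.congr (Eventually.of_forall fun r => ?_)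
    have : (0 : ℝ) ≤ (r : ℝ) ^ (n - 1) := pow_nonneg (le_of_lt r.2) _
    simp [hP, ENNReal.toReal_ofReal this]
  · calc ∫ x, G x = ∫ x : ({(0)}ᶜ : Set (Euc n)), G x ∂(Measure.comap Subtype.val volume) := by
          rw [integral_subtype_comap (measurableSet_singleton _).compl, restrict_compl_singleton]
      _ = ∫ x : ({(0)}ᶜ : Set (Euc n)), P (homeomorphUnitSphereProd (Euc n) x)
            ∂(Measure.comap Subtype.val volume) := by simp_rw [hPe]
      _ = _ := by
          rw [hmp.integral_comp hme, integral_prod _ hPi]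
          simp_rw [hin]

/-- Integrating the radial derivative of a compactly supported function against `|x|^(1-n)`
evaluates the function at the origin. -/
theorem integral_inv_norm_pow_mul_radial_deriv {n : ℕ} (hn : 3 ≤ n) {Φ D : Euc n → ℝ}
    (hΦ : ContinuousAt Φ 0) (hΦc : HasCompactSupport Φ)
    (hD : ∀ θ : Euc n, ‖θ‖ = 1 → ∀ r : ℝ, 0 < r →
      HasDerivAt (fun s : ℝ => Φ (s • θ)) (D (r • θ)) r)
    (hi : Integrable fun x => (‖x‖ ^ (n - 1))⁻¹ * D x) :
    ∫ x, (‖x‖ ^ (n - 1))⁻¹ * D x =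
      -((volume : Measure (Euc n)).toSphere.real univ * Φ 0) := by
  obtain ⟨h1, h2⟩ := ae_integrableOn_and_integral_eq_polar hn hi
  have key : ∀ θ : sphere (0 : Euc n) 1, ∀ r ∈ Ioi (0 : ℝ),
      r ^ (n - 1) * ((‖r • (θ : Euc n)‖ ^ (n - 1))⁻¹ * D (r • (θ : Euc n))) =
        D (r • (θ : Euc n)) := by
    intro θ r hr
    have hr' : (0 : ℝ) < r := hr
    have hθ : ‖(θ : Euc n)‖ = 1 := by simp
    rw [norm_smul, hθ, mul_one, Real.norm_of_nonneg hr'.le, ← mul_assoc,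
      mul_inv_cancel₀ (pow_pos hr' _).ne', one_mul]
  rw [h2]
  have h3 : ∀ᵐ θ : sphere (0 : Euc n) 1 ∂(volume : Measure (Euc n)).toSphere,
      ∫ r in Ioi (0 : ℝ), r ^ (n - 1) *
        ((‖r • (θ : Euc n)‖ ^ (n - 1))⁻¹ * D (r • (θ : Euc n))) = -Φ 0 := by
    filter_upwards [h1] with θ hθi
    have hθ : ‖(θ : Euc n)‖ = 1 := by simp
    rw [setIntegral_congr_fun measurableSet_Ioi (key θ)]
    have hθi' := hθi.congr_fun (key θ) measurableSet_Ioi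
    obtain ⟨T, hT⟩ := hΦc.isCompact.isBounded.subset_closedBall 0
    have := integral_Ioi_of_hasDerivAt_of_tendsto (a := (0 : ℝ)) (m := 0)
      (f := fun s : ℝ => Φ (s • (θ : Euc n))) ?_ (fun r hr => hD θ hθ r hr) hθi' ?_
    · simpa using this
    · refine ContinuousAt.continuousWithinAt ?_
      refine ContinuousAt.comp (f := fun s : ℝ => s • (θ : Euc n)) (g := Φ) (by simpa using hΦ) ?_
      fun_prop
    · refine tendsto_const_nhds.congr' ?_
      filter_upwards [eventually_gt_atTop (max T 0)] with s hs
      refine (image_eq_zero_of_notMem_tsupport (f := Φ) fun hmem => ?_).symm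
      have := hT hmem
      rw [mem_closedBall_zero_iff, norm_smul, hθ, mul_one, Real.norm_eq_abs] at this
      have := le_abs_self s
      have := le_max_left T 0
      linarith
  rw [integral_congr_ae h3, integral_const]
  simp

/-- The integrating factor `exp (-(m/β) (1 - t)^β)` of the radial drift `m (1 - t)^(β-1)`. -/
def radialWeight (β m t : ℝ) : ℝ := Real.exp (-(m / β) * (1 - t) ^ β)

/-- Minus the derivative of the radial profile `radialGreen`. -/
def radialFlux (n : ℕ) (β m t : ℝ) : ℝ := (t ^ (n - 1))⁻¹ * radialWeight β m t

/-- The radial profile `∫_r^1 t^(1-n) exp (-(m/β) (1 - t)^β) dt`, a fundamental solution for the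
radial drift `m (1 - t)^(β-1)` up to normalization. -/
def radialGreen (n : ℕ) (β m r : ℝ) : ℝ := ∫ t in r..1, radialFlux n β m t

section Radial

variable {n : ℕ} {β : ℝ} (m : ℝ)

theorem radialWeight_pos (β m t : ℝ) : 0 < radialWeight β m t := Real.exp_pos _

theorem continuous_radialWeight (hβ : 0 < β) : Continuous (radialWeight β m) := by
  unfold radialWeight
  have : Continuous fun t : ℝ => (1 - t) ^ β :=
    (continuous_const.sub continuous_id).rpow_const fun x => Or.inr hβ.le
  fun_prop

theorem radialWeight_le (hβ : 0 < β) {t : ℝ} (h0 : 0 ≤ t) (h1 : t ≤ 1) :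
    radialWeight β m t ≤ Real.exp (|m| / β) := by
  refine Real.exp_le_exp.2 ?_
  have h2 : (1 - t) ^ β ≤ 1 := Real.rpow_le_one (by linarith) (by linarith) hβ.le
  have h3 : 0 ≤ (1 - t) ^ β := Real.rpow_nonneg (by linarith) _
  calc -(m / β) * (1 - t) ^ β ≤ |-(m / β) * (1 - t) ^ β| := le_abs_self _
    _ = |m| / β * (1 - t) ^ β := by
        rw [abs_mul, abs_neg, abs_div, abs_of_pos hβ, abs_of_nonneg h3]
    _ ≤ |m| / β * 1 := by gcongr
    _ = _ := mul_one _

theorem one_le_radialWeight (hβ : 0 < β) (hm : m ≤ 0) {t : ℝ} (h1 : t ≤ 1) :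
    1 ≤ radialWeight β m t := by
  refine Real.one_le_exp ?_
  have h3 : 0 ≤ (1 - t) ^ β := Real.rpow_nonneg (by linarith) _
  have : m / β ≤ 0 := div_nonpos_of_nonpos_of_nonneg hm hβ.le
  nlinarith

theorem hasDerivAt_radialWeight (hβ : 0 < β) {t : ℝ} (h1 : t < 1) :
    HasDerivAt (radialWeight β m) (m * (1 - t) ^ (β - 1) * radialWeight β m t) t := by
  have h := (((hasDerivAt_id t).const_sub 1).rpow_const (p := β)
    (Or.inl (by simp only [id]; linarith))).const_mul (-(m / β))
  refine h.exp.congr_deriv ?_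
  simp only [radialWeight, id]
  field_simp

theorem continuousOn_radialFlux (hβ : 0 < β) : ContinuousOn (radialFlux n β m) (Ioi 0) := by
  refine ContinuousOn.mul (ContinuousOn.inv₀ (by fun_prop) fun t ht => ?_)
    (continuous_radialWeight m hβ).continuousOn
  exact (pow_pos ht _).ne'

theorem radialFlux_nonneg {t : ℝ} (ht : 0 ≤ t) : 0 ≤ radialFlux n β m t :=
  mul_nonneg (inv_nonneg.2 (pow_nonneg ht _)) (radialWeight_pos β m t).le

theorem intervalIntegrable_radialFlux (hβ : 0 < β) {r s : ℝ} (hr : 0 < r) (hs : 0 < s) :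
    IntervalIntegrable (radialFlux n β m) volume r s := by
  refine ((continuousOn_radialFlux m hβ).mono fun t ht => ?_).intervalIntegrable
  exact lt_of_lt_of_le (lt_min hr hs) ht.1

theorem hasDerivAt_radialGreen (hβ : 0 < β) {r : ℝ} (hr : 0 < r) :
    HasDerivAt (radialGreen n β m) (-radialFlux n β m r) r := by
  have hca := (continuousOn_radialFlux (n := n) m hβ).continuousAt (Ioi_mem_nhds hr)
  refine intervalIntegral.integral_hasDerivAt_left
    (intervalIntegrable_radialFlux m hβ hr one_pos) ?_ hca
  exact (continuousOn_radialFlux m hβ).stronglyMeasurableAtFilter isOpen_Ioi r hr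

theorem radialFlux_le (hβ : 0 < β) {r : ℝ} (hr : 0 < r) (h1 : r ≤ 1) :
    radialFlux n β m r ≤ Real.exp (|m| / β) * (r ^ (n - 1))⁻¹ := by
  rw [radialFlux, mul_comm]
  have := radialWeight_le m hβ hr.le h1
  gcongr

theorem abs_radialGreen_le (hβ : 0 < β) {r : ℝ} (hr : 0 < r) (h1 : r ≤ 1) :
    |radialGreen n β m r| ≤ Real.exp (|m| / β) * (r ^ (n - 1))⁻¹ := by
  have h := intervalIntegral.norm_integral_le_of_norm_le_const (a := r) (b := 1)
    (f := radialFlux n β m) (C := Real.exp (|m| / β) * (r ^ (n - 1))⁻¹) fun t ht => ?_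
  · refine h.trans (mul_le_of_le_one_right (by positivity) ?_)
    rw [abs_of_nonneg (by linarith)]
    linarith
  · rw [uIoc_of_le h1] at ht
    have ht0 : 0 < t := hr.trans ht.1
    rw [Real.norm_of_nonneg (radialFlux_nonneg m ht0.le)]
    refine (radialFlux_le m hβ ht0 ht.2).trans ?_
    have := ht.1.le
    gcongr

theorem neg_log_le_radialGreen (hn : 3 ≤ n) (hβ : 0 < β) (hm : m ≤ 0) {r : ℝ} (hr : 0 < r)
    (h1 : r ≤ 1) : -Real.log r ≤ radialGreen n β m r := by
  have h : ∫ t in r..1, t⁻¹ = -Real.log r := by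
    rw [integral_inv_of_pos hr one_pos, one_div, Real.log_inv]
  rw [← h]
  refine intervalIntegral.integral_mono_on h1 ?_ (intervalIntegrable_radialFlux m hβ hr one_pos)
    fun t ht => ?_
  · refine intervalIntegral.intervalIntegrable_inv (fun t ht => ?_) continuousOn_id
    rw [uIcc_of_le h1] at ht
    exact (hr.trans_le ht.1).ne'
  · have ht0 : 0 < t := hr.trans_le ht.1
    have h2 := one_le_radialWeight m hβ hm ht.2
    have h3 : t ^ (n - 1) ≤ t := by
      calc t ^ (n - 1) ≤ t ^ 1 := pow_le_pow_of_le_one ht0.le ht.2 (by omega)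
        _ = t := pow_one t
    calc t⁻¹ ≤ (t ^ (n - 1))⁻¹ := by gcongr
      _ = (t ^ (n - 1))⁻¹ * 1 := (mul_one _).symm
      _ ≤ _ := by unfold radialFlux; gcongr

theorem radialGreen_nonneg {r : ℝ} (hr : 0 < r) (h1 : r ≤ 1) :
    0 ≤ radialGreen n β m r :=
  intervalIntegral.integral_nonneg h1 fun _ ht => radialFlux_nonneg m (hr.le.trans ht.1)

theorem hasFDerivAt_norm_euc {x : Euc n} (hx : x ≠ 0) :
    HasFDerivAt (fun y : Euc n => ‖y‖) (‖x‖⁻¹ • innerSL ℝ x) x := by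
  have h := ((hasStrictFDerivAt_norm_sq x).hasFDerivAt).sqrt
    (by simpa using hx)
  simp only [Real.sqrt_sq (norm_nonneg _)] at h
  refine h.congr_fderiv ?_
  ext y
  have := norm_ne_zero_iff.2 hx
  simp
  field_simp

theorem hasFDerivAt_radialGreen_norm (hβ : 0 < β) {x : Euc n} (hx : x ≠ 0) :
    HasFDerivAt (fun y : Euc n => radialGreen n β m ‖y‖)
      (-radialFlux n β m ‖x‖ • (‖x‖⁻¹ • innerSL ℝ x)) x :=
  (hasDerivAt_radialGreen m hβ (norm_pos_iff.2 hx)).comp_hasFDerivAt x (hasFDerivAt_norm_euc hx)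

theorem norm_fderiv_radialGreen_norm_le (hβ : 0 < β) {x : Euc n} (hx : x ≠ 0) (h1 : ‖x‖ ≤ 1) :
    ‖fderiv ℝ (fun y : Euc n => radialGreen n β m ‖y‖) x‖ ≤
      Real.exp (|m| / β) * (‖x‖ ^ (n - 1))⁻¹ := by
  have hx' := norm_pos_iff.2 hx
  rw [(hasFDerivAt_radialGreen_norm m hβ hx).fderiv, norm_smul, norm_smul, norm_neg, norm_inv,
    norm_norm, innerSL_apply_norm, inv_mul_cancel₀ hx'.ne', mul_one,
    Real.norm_of_nonneg (radialFlux_nonneg m hx'.le)]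
  exact radialFlux_le m hβ hx' h1

theorem integrableOn_inv_norm_pow (hn : 3 ≤ n) :
    IntegrableOn (fun x : Euc n => (‖x‖ ^ (n - 1))⁻¹) (ball 0 1) := by
  have := Euc.nontrivial hn
  rw [integrableOn_fun_norm_addHaar (μ := (volume : Measure (Euc n)))
    (f := fun r : ℝ => (r ^ (n - 1))⁻¹)]
  have : EqOn (fun _ : ℝ => (1 : ℝ)) (fun y : ℝ => y ^ (Module.finrank ℝ (Euc n) - 1) •
      (y ^ (n - 1))⁻¹) (Ioo 0 1) := by
    intro y hy
    have : y ^ (n - 1) ≠ 0 := (pow_pos hy.1 _).ne'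
    simp [this]
  exact IntegrableOn.congr_fun (by simp) this measurableSet_Ioo

theorem integrableOn_radialGreen_norm (hn : 3 ≤ n) (hβ : 0 < β) :
    IntegrableOn (fun x : Euc n => radialGreen n β m ‖x‖) (ball 0 1) := by
  refine ((integrableOn_inv_norm_pow hn).const_mul (Real.exp (|m| / β))).mono' ?_ ?_
  · exact (measurable_of_differentiableAt_ne_zero fun x hx =>
      (hasFDerivAt_radialGreen_norm m hβ hx).differentiableAt).aestronglyMeasurable
  · filter_upwards [ae_restrict_mem measurableSet_ball, ae_restrict_of_ae (Euc.ae_ne_zero hn)]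
      with x hx hx0
    exact abs_radialGreen_le m hβ (norm_pos_iff.2 hx0) (mem_ball_zero_iff.1 hx).le

theorem integrableOn_fderiv_radialGreen_norm (hn : 3 ≤ n) (hβ : 0 < β) :
    IntegrableOn (fderiv ℝ fun x : Euc n => radialGreen n β m ‖x‖) (ball 0 1) := by
  refine ((integrableOn_inv_norm_pow hn).const_mul (Real.exp (|m| / β))).mono'
    (measurable_fderiv ℝ _).aestronglyMeasurable ?_
  filter_upwards [ae_restrict_mem measurableSet_ball, ae_restrict_of_ae (Euc.ae_ne_zero hn)]
    with x hx hx0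
  exact norm_fderiv_radialGreen_norm_le m hβ hx0 (mem_ball_zero_iff.1 hx).le

theorem exists_radialGreen_lt (hβ : 0 < β) {ε : ℝ} (hε : 0 < ε) :
    ∃ t < (1 : ℝ), ∀ r, t < r → r < 1 → |radialGreen n β m r| < ε := by
  have h := (hasDerivAt_radialGreen (n := n) m hβ one_pos).continuousAt
  rw [Metric.continuousAt_iff] at h
  obtain ⟨d, hd, h⟩ := h ε hε
  refine ⟨1 - d, by linarith, fun r h1 h2 => ?_⟩
  have h3 := h (x := r) (by rw [Real.dist_eq, abs_lt]; constructor <;> linarith)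
  simpa [Real.dist_eq, radialGreen] using h3

end Radial

/-- The integrand of the weak form of `-Δu + B·∇u` tested against `φ`. -/
def weakIntegrand {n : ℕ} (B : Euc n → Euc n) (u φ : Euc n → ℝ) (x : Euc n) : ℝ :=
  (∑ i : Fin n, fderiv ℝ u x (EuclideanSpace.single i 1) *
    fderiv ℝ φ x (EuclideanSpace.single i 1)) + fderiv ℝ u x (B x) * φ x

theorem integrableOn_weakIntegrand {n : ℕ} {B : Euc n → Euc n} (hB : ContinuousOn B (ball 0 1))
    {u φ : Euc n → ℝ} (hu : IntegrableOn (fderiv ℝ u) (ball 0 1)) (hφ : ContDiff ℝ (⊤ : ℕ∞) φ)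
    (hφc : HasCompactSupport φ) (hφs : tsupport φ ⊆ ball 0 1) :
    IntegrableOn (weakIntegrand B u φ) (ball 0 1) := by
  have hpart : ∀ (e : Euc n) (f : Euc n → ℝ), Continuous f → HasCompactSupport f →
      IntegrableOn (fun x => fderiv ℝ u x e * f x) (ball 0 1) := by
    intro e f hf hfc
    obtain ⟨C, hC⟩ := hfc.exists_bound_of_continuous hf
    exact (hu.apply_continuousLinearMap e).mul_bdd hf.aestronglyMeasurable
      (Eventually.of_forall hC)
  have h1 : IntegrableOn (fun x => ∑ i : Fin n, fderiv ℝ u x (EuclideanSpace.single i 1) *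
      fderiv ℝ φ x (EuclideanSpace.single i 1)) (ball 0 1) :=
    integrable_finsetSum _ fun i _ => hpart _ _ (contDiff_fderiv_apply hφ _).continuous
      (hφc.fderiv_apply ℝ _)
  have h2 : IntegrableOn (fun x => ∑ i : Fin n, fderiv ℝ u x (EuclideanSpace.single i 1) *
      (B x i * φ x)) (ball 0 1) := by
    refine integrable_finsetSum _ fun i _ => hpart _ _ ?_ hφc.mul_left
    refine ContinuousOn.continuous_of_tsupport_subset (s := ball 0 1) ?_ isOpen_ball
      ((tsupport_mul_subset_right).trans hφs)
    exact ((EuclideanSpace.proj (𝕜 := ℝ) i).continuous.comp_continuousOn hB).mul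
      hφ.continuous.continuousOn
  refine (h1.add h2).congr (Eventually.of_forall fun x => ?_)
  simp only [weakIntegrand, Pi.add_apply]
  rw [clm_apply_eq_sum (fderiv ℝ u x) (B x), Finset.sum_mul]
  simp_rw [mul_assoc]

theorem integral_weakIntegrand_radialGreen {n : ℕ} (hn : 3 ≤ n) {β : ℝ} (hβ : 0 < β) (m : ℝ)
    {B : Euc n → Euc n} (hB : ContinuousOn B (ball 0 1)) {φ : Euc n → ℝ}
    (hφ : ContDiff ℝ (⊤ : ℕ∞) φ) (hφc : HasCompactSupport φ) (hφs : tsupport φ ⊆ ball 0 1) :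
    ∫ x in ball (0 : Euc n) 1, weakIntegrand B (fun x => radialGreen n β m ‖x‖) φ x =
      (volume : Measure (Euc n)).toSphere.real univ * radialWeight β m 0 * φ 0 +
      ∫ x in ball (0 : Euc n) 1, radialFlux n β m ‖x‖ * φ x *
        (m * (1 - ‖x‖) ^ (β - 1) - ‖x‖⁻¹ * ⟪x, B x⟫) := by
  set D : Euc n → ℝ := fun x => m * (1 - ‖x‖) ^ (β - 1) * radialWeight β m ‖x‖ * φ x +
    radialWeight β m ‖x‖ * (‖x‖⁻¹ * fderiv ℝ φ x x) with hD
  have hq := continuous_radialWeight m hβ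
  have hφ0 : ∀ x ∉ tsupport φ, φ x = 0 := fun x hx => image_eq_zero_of_notMem_tsupport hx
  have hφ1 : ∀ x ∉ tsupport φ, fderiv ℝ φ x = 0 := fun x hx => by
    by_contra h
    exact hx (support_fderiv_subset ℝ h)
  have hD0 : ∀ x ∉ tsupport φ, D x = 0 := fun x hx => by
    simp [hD, hφ0 x hx, hφ1 x hx]
  have hcont1 : Continuous fun x : Euc n => m * (1 - ‖x‖) ^ (β - 1) * radialWeight β m ‖x‖ * φ x := by
    refine ContinuousOn.continuous_of_tsupport_subset (s := ball 0 1) ?_ isOpen_ball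
      ((tsupport_mul_subset_right).trans hφs)
    refine ContinuousOn.mul (ContinuousOn.mul (continuousOn_const.mul ?_)
      (hq.comp continuous_norm).continuousOn) hφ.continuous.continuousOn
    refine ContinuousOn.rpow_const (by fun_prop) fun x hx => Or.inl ?_
    have := mem_ball_zero_iff.1 hx
    linarith
  obtain ⟨C1, hC1⟩ := (hφc.mul_left (f := fun x : Euc n =>
    m * (1 - ‖x‖) ^ (β - 1) * radialWeight β m ‖x‖)).exists_bound_of_continuous hcont1
  obtain ⟨C2, hC2⟩ := (hφc.fderiv (𝕜 := ℝ)).exists_bound_of_continuous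
    (hφ.continuous_fderiv (by simp))
  have hC2' : 0 ≤ C2 := (norm_nonneg _).trans (hC2 0)
  have hDb : ∀ x ∈ ball (0 : Euc n) 1, ‖D x‖ ≤ C1 + Real.exp (|m| / β) * C2 := by
    intro x hx
    have hx1 := (mem_ball_zero_iff.1 hx).le
    refine (norm_add_le _ _).trans (add_le_add (hC1 x) ?_)
    rw [norm_mul, Real.norm_of_nonneg (radialWeight_pos β m _).le]
    refine mul_le_mul (radialWeight_le m hβ (norm_nonneg _) hx1) ?_ (norm_nonneg _)
      (Real.exp_pos _).le
    rw [norm_mul, norm_inv, norm_norm]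
    calc ‖x‖⁻¹ * ‖fderiv ℝ φ x x‖ ≤ ‖x‖⁻¹ * (C2 * ‖x‖) := by
          gcongr
          exact (fderiv ℝ φ x).le_of_opNorm_le (hC2 x) x
      _ = C2 * (‖x‖⁻¹ * ‖x‖) := by ring
      _ ≤ C2 * 1 := by
          gcongr
          exact inv_mul_le_one
      _ = C2 := mul_one _
  have hDm : AEStronglyMeasurable D := by
    have hm : Measurable fun x : Euc n => fderiv ℝ φ x x :=
      ((hφ.continuous_fderiv (by simp)).clm_apply continuous_id).measurable
    exact (hcont1.measurable.add ((hq.comp continuous_norm).measurable.mul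
      (measurable_norm.inv.mul hm))).aestronglyMeasurable
  have hi : IntegrableOn (fun x : Euc n => (‖x‖ ^ (n - 1))⁻¹ * D x) (ball 0 1) :=
    (integrableOn_inv_norm_pow hn).mul_bdd hDm.restrict
      ((ae_restrict_mem measurableSet_ball).mono hDb)
  have hz : ∀ x ∉ ball (0 : Euc n) 1, (‖x‖ ^ (n - 1))⁻¹ * D x = 0 := fun x hx => by
    rw [hD0 x fun h => hx (hφs h), mul_zero]
  have hi' : Integrable fun x : Euc n => (‖x‖ ^ (n - 1))⁻¹ * D x :=
    (integrableOn_iff_integrable_of_support_subset fun x hx => by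
      by_contra h
      exact hx (hz x h)).1 hi
  have hflux := integral_inv_norm_pow_mul_radial_deriv hn
    (Φ := fun x => radialWeight β m ‖x‖ * φ x) (D := D)
    ((hq.comp continuous_norm).mul hφ.continuous).continuousAt hφc.mul_left ?_ hi'
  swap
  · intro θ hθ r hr
    by_cases hmem : r • θ ∈ tsupport φ
    · have hnorm : ∀ s : ℝ, 0 < s → ‖s • θ‖ = s := fun s hs => by
        rw [norm_smul, hθ, mul_one, Real.norm_of_nonneg hs.le]
      have hr1 : r < 1 := by
        have := mem_ball_zero_iff.1 (hφs hmem)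
        rwa [hnorm r hr] at this
      have h1 : HasDerivAt (fun s : ℝ => φ (s • θ)) (fderiv ℝ φ (r • θ) θ) r := by
        have hs : HasDerivAt (fun s : ℝ => s • θ) θ r := by
          simpa using (hasDerivAt_id r).smul_const θ
        exact (hφ.differentiable (by simp) _).hasFDerivAt.comp_hasDerivAt r hs
      have h2 := (hasDerivAt_radialWeight m hβ hr1).mul h1
      have h3 := h2.congr_of_eventuallyEq (f₁ := fun s : ℝ => radialWeight β m ‖s • θ‖ * φ (s • θ))
        ((eventually_gt_nhds hr).mono fun s hs => by simp only [hnorm s hs, Pi.mul_apply])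
      refine h3.congr_deriv ?_
      simp only [hD, hnorm r hr, map_smul, smul_eq_mul]
      field_simp
    · rw [hD0 _ hmem]
      refine (hasDerivAt_const r (0 : ℝ)).congr_of_eventuallyEq ?_
      have hcs : Continuous fun s : ℝ => s • θ := by fun_prop
      filter_upwards [hcs.continuousAt.eventually
        ((isClosed_tsupport φ).isOpen_compl.mem_nhds hmem)] with s hs
      rw [hφ0 _ hs, mul_zero]
  have hwi := integrableOn_weakIntegrand hB
    (integrableOn_fderiv_radialGreen_norm m hn hβ) hφ hφc hφs
  have hsum : ∀ᵐ x ∂volume.restrict (ball (0 : Euc n) 1),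
      weakIntegrand B (fun x => radialGreen n β m ‖x‖) φ x + (‖x‖ ^ (n - 1))⁻¹ * D x =
      radialFlux n β m ‖x‖ * φ x * (m * (1 - ‖x‖) ^ (β - 1) - ‖x‖⁻¹ * ⟪x, B x⟫) := by
    filter_upwards [ae_restrict_of_ae (Euc.ae_ne_zero hn)] with x hx
    rw [weakIntegrand, (hasFDerivAt_radialGreen_norm m hβ hx).fderiv]
    have h1 : ∑ i : Fin n, (-radialFlux n β m ‖x‖ • (‖x‖⁻¹ • innerSL ℝ x))
        (EuclideanSpace.single i 1) * fderiv ℝ φ x (EuclideanSpace.single i 1) =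
        -radialFlux n β m ‖x‖ * ‖x‖⁻¹ * fderiv ℝ φ x x := by
      rw [clm_apply_eq_sum (fderiv ℝ φ x) x, Finset.mul_sum]
      refine Finset.sum_congr rfl fun i _ => ?_
      simp [EuclideanSpace.inner_single_right]
      ring
    rw [h1]
    simp [hD, radialFlux]
    ring
  rw [← integral_congr_ae hsum, integral_add hwi hi, setIntegral_eq_integral_of_forall_compl_eq_zero hz,
    hflux]
  simp
  ring

theorem mul_le_integral_weakIntegrand_radialGreen {n : ℕ} (hn : 3 ≤ n) {β M : ℝ} (hβ : 0 < β)
    {B : Euc n → Euc n} (hB : AdmissibleDrift β M B) {φ : Euc n → ℝ}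
    (hφ : ContDiff ℝ (⊤ : ℕ∞) φ) (hφc : HasCompactSupport φ) (hφs : tsupport φ ⊆ ball 0 1)
    (hφ0 : ∀ x, 0 ≤ φ x) :
    (volume : Measure (Euc n)).toSphere.real univ * radialWeight β M 0 * φ 0 ≤
      ∫ x in ball (0 : Euc n) 1, weakIntegrand B (fun x => radialGreen n β M ‖x‖) φ x ∧
    ∫ x in ball (0 : Euc n) 1, weakIntegrand B (fun x => radialGreen n β (-M) ‖x‖) φ x ≤
      (volume : Measure (Euc n)).toSphere.real univ * radialWeight β (-M) 0 * φ 0 := by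
  have key : ∀ x ∈ ball (0 : Euc n) 1, |‖x‖⁻¹ * ⟪x, B x⟫| ≤ M * (1 - ‖x‖) ^ (β - 1) := by
    intro x hx
    have hx1 : 0 < 1 - ‖x‖ := by linarith [mem_ball_zero_iff.1 hx]
    have h1 := hB.2.1 x hx
    have h2 : ‖B x‖ ≤ M * (1 - ‖x‖) ^ (β - 1) := by
      have h3 : (1 - ‖x‖) ^ (β - 1) * (1 - ‖x‖) ^ (1 - β) = 1 := by
        rw [← Real.rpow_add hx1]
        simp
      have h4 := mul_le_mul_of_nonneg_left h1 (Real.rpow_nonneg hx1.le (β - 1))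
      rw [← mul_assoc, h3, one_mul] at h4
      linarith
    refine le_trans ?_ h2
    rw [abs_mul, abs_of_nonneg (inv_nonneg.2 (norm_nonneg x))]
    calc ‖x‖⁻¹ * |⟪x, B x⟫| ≤ ‖x‖⁻¹ * (‖x‖ * ‖B x‖) := by
          gcongr
          exact abs_real_inner_le_norm _ _
      _ = (‖x‖⁻¹ * ‖x‖) * ‖B x‖ := by ring
      _ ≤ 1 * ‖B x‖ := by
          gcongr
          exact inv_mul_le_one
      _ = _ := one_mul _
  have hBc := hB.1.continuousOn
  rw [integral_weakIntegrand_radialGreen hn hβ M hBc hφ hφc hφs,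
    integral_weakIntegrand_radialGreen hn hβ (-M) hBc hφ hφc hφs]
  constructor
  · refine le_add_of_nonneg_right (setIntegral_nonneg measurableSet_ball fun x hx => ?_)
    refine mul_nonneg (mul_nonneg (radialFlux_nonneg _ (norm_nonneg _)) (hφ0 x)) ?_
    linarith [(abs_le.1 (key x hx)).2]
  · refine add_le_of_nonpos_right (setIntegral_nonpos measurableSet_ball fun x hx => ?_)
    refine mul_nonpos_of_nonneg_of_nonpos
      (mul_nonneg (radialFlux_nonneg _ (norm_nonneg _)) (hφ0 x)) ?_
    linarith [(abs_le.1 (key x hx)).1]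

/-- Weak maximum principle on the unit ball for `W^{1,1}` subsolutions which are differentiable
away from the origin. -/
theorem nonpos_of_weak_subsolution {n : ℕ} (hn : 3 ≤ n) {B : Euc n → Euc n}
    (hB : ContDiffOn ℝ 1 B (ball 0 1)) (hdiv : ∀ x ∈ ball (0 : Euc n) 1, divg B x ≤ 0)
    {u : Euc n → ℝ} (hd : ∀ x ∈ ball (0 : Euc n) 1, x ≠ 0 → DifferentiableAt ℝ u x)
    (hu : IntegrableOn u (ball 0 1)) (hdu : IntegrableOn (fderiv ℝ u) (ball 0 1))
    (hbd : ∀ ε > 0, ∃ t < (1 : ℝ), ∀ x ∈ ball (0 : Euc n) 1, t < ‖x‖ → u x < ε)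
    (hweak : ∀ φ : Euc n → ℝ, ContDiff ℝ (⊤ : ℕ∞) φ → HasCompactSupport φ →
      tsupport φ ⊆ ball 0 1 → (∀ x, 0 ≤ φ x) →
      ∫ x in ball (0 : Euc n) 1, weakIntegrand B u φ x ≤ 0) :
    ∀ x ∈ ball (0 : Euc n) 1, x ≠ 0 → u x ≤ 0 := by
  intro x₀ hx₀ hx₀0
  refine le_of_forall_pos_le_add fun ε hε => ?_
  rw [zero_add]
  obtain ⟨t, ht1, ht⟩ := hbd ε hε
  obtain ⟨R, hR0, hRt, hR1⟩ : ∃ R : ℝ, 0 < R ∧ t < R ∧ R < 1 := by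
    obtain ⟨R, h1, h2⟩ := exists_between (max_lt ht1 one_pos)
    exact ⟨R, (le_max_right _ _).trans_lt h1, (le_max_left _ _).trans_lt h1, h2⟩
  rcases le_or_gt R ‖x₀‖ with hx₀R | hx₀R
  · exact (ht x₀ hx₀ (hRt.trans_le hx₀R)).le
  obtain ⟨R', hRR', hR'1⟩ := exists_between hR1
  obtain ⟨R'', hR'R'', hR''1⟩ := exists_between hR'1
  let ζ : ContDiffBump (0 : Euc n) := ⟨R', R'', hR0.trans hRR', hR'R''⟩
  have hζs : ContDiff ℝ (⊤ : ℕ∞) ζ := ζ.contDiff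
  have hζ1 : ContDiff ℝ 1 ζ := ζ.contDiff
  have hζt : tsupport ζ ⊆ ball 0 1 := by
    rw [ζ.tsupport_eq]
    exact closedBall_subset_ball hR''1
  have hζc : HasCompactSupport ζ := ζ.hasCompactSupport
  have hζone : ∀ x ∈ ball (0 : Euc n) R', ∀ᶠ y in 𝓝 x, ζ y = 1 := fun x hx => by
    filter_upwards [isOpen_ball.mem_nhds hx] with y hy
    exact ζ.one_of_mem_closedBall (ball_subset_closedBall hy)
  obtain ⟨C, hC⟩ := (hζc.fderiv (𝕜 := ℝ)).exists_bound_of_continuous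
    (hζs.continuous_fderiv (by simp))
  set U : Euc n → ℝ := fun x => ζ x * u x with hU
  set A : Euc n → Euc n := fun x => ζ x • B x with hA
  have hUt : tsupport U ⊆ tsupport ζ := tsupport_mul_subset_left
  have hAt : tsupport A ⊆ tsupport ζ := closure_mono fun x hx h => hx (by simp [hA, h])
  have hAs : ContDiff ℝ 1 A := contDiff_iff_contDiffAt.2 fun x => by
    by_cases hx : x ∈ tsupport A
    · exact hζ1.contDiffAt.smul (hB.contDiffAt (isOpen_ball.mem_nhds (hζt (hAt hx))))
    · have : A =ᶠ[𝓝 x] fun _ => 0 := notMem_tsupport_iff_eventuallyEq.1 hx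
      exact contDiffAt_const.congr_of_eventuallyEq this
  have hAc : HasCompactSupport A := hζc.smul_right
  obtain ⟨K, hK⟩ := hAc.exists_bound_of_continuous hAs.continuous
  have hUd : ∀ x ∈ ball (0 : Euc n) 1, x ≠ 0 →
      HasFDerivAt U (ζ x • fderiv ℝ u x + u x • fderiv ℝ ζ x) x := fun x hx hx0 =>
    (hζ1.differentiable (by simp) x).hasFDerivAt.mul (hd x hx hx0).hasFDerivAt
  have hUz : ∀ x ∉ ball (0 : Euc n) 1, fderiv ℝ U x = 0 := fun x hx => by
    by_contra h
    exact hx (hζt (hUt (support_fderiv_subset ℝ h)))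
  have hUdiff : ∀ x ≠ 0, DifferentiableAt ℝ U x := fun x hx0 => by
    by_cases hx : x ∈ tsupport U
    · exact (hUd x (hζt (hUt hx)) hx0).differentiableAt
    · have : U =ᶠ[𝓝 x] fun _ => 0 := notMem_tsupport_iff_eventuallyEq.1 hx
      exact (differentiableAt_const (0 : ℝ)).congr_of_eventuallyEq this
  have hUi : Integrable U := by
    refine (integrableOn_iff_integrable_of_support_subset (s := ball (0 : Euc n) 1) ?_).1 ?_
    · exact (subset_tsupport U).trans (hUt.trans hζt)
    · refine hu.bdd_mul (c := 1) hζ1.continuous.aestronglyMeasurable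
        (Eventually.of_forall fun x => ?_)
      rw [Real.norm_of_nonneg ζ.nonneg]
      exact ζ.le_one
  have hdUi : Integrable (fderiv ℝ U) := by
    have hdom : Integrable ((ball (0 : Euc n) 1).indicator
        fun x => ‖fderiv ℝ u x‖ + ‖u x‖ * C) :=
      (integrable_indicator_iff measurableSet_ball).2 (hdu.norm.add (hu.norm.mul_const C))
    refine hdom.mono' (measurable_fderiv ℝ U).aestronglyMeasurable ?_
    filter_upwards [Euc.ae_ne_zero hn] with x hx0
    by_cases hx : x ∈ ball (0 : Euc n) 1
    · rw [indicator_of_mem hx, (hUd x hx hx0).fderiv]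
      refine (norm_add_le _ _).trans ?_
      rw [norm_smul, norm_smul, Real.norm_of_nonneg ζ.nonneg]
      have h2 : ζ x * ‖fderiv ℝ u x‖ ≤ 1 * ‖fderiv ℝ u x‖ := by
        gcongr
        exact ζ.le_one
      have h3 : ‖u x‖ * ‖fderiv ℝ ζ x‖ ≤ ‖u x‖ * C := by
        gcongr
        exact hC x
      linarith
    · rw [indicator_of_notMem hx, hUz x hx, norm_zero]
  have hUε : ∀ x, R ≤ ‖x‖ → U x ≤ ε := by
    intro x hx
    by_cases hx1 : x ∈ ball (0 : Euc n) 1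
    · have h1 := ht x hx1 (hRt.trans_le hx)
      have h2 := mul_le_mul_of_nonneg_left h1.le (ζ.nonneg (x := x))
      have h3 := mul_le_mul_of_nonneg_right (ζ.le_one (x := x)) hε.le
      simp only [hU]
      linarith
    · have : ζ x = 0 := image_eq_zero_of_notMem_tsupport fun h => hx1 (hζt h)
      simp only [hU, this, zero_mul]
      exact hε.le
  have hdivA : ∀ x ∈ ball (0 : Euc n) R', divg A x ≤ 0 := by
    intro x hx
    have h1 : A =ᶠ[𝓝 x] B := (hζone x hx).mono fun y hy => by simp only [hA, hy, one_smul]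
    have h2 := hdiv x (ball_subset_ball hR'1.le hx)
    simp only [divg] at h2 ⊢
    rwa [h1.fderiv_eq]
  have hwk : ∀ φ : Euc n → ℝ, ContDiff ℝ (⊤ : ℕ∞) φ → HasCompactSupport φ →
      tsupport φ ⊆ ball 0 R' → (∀ x, 0 ≤ φ x) → ∫ x, weakIntegrand A U φ x ≤ 0 := by
    intro φ hφ hφc hφs hφ0
    refine le_of_eq_of_le ?_ (hweak φ hφ hφc (hφs.trans (ball_subset_ball hR'1.le)) hφ0)
    have hoff : ∀ (b : Euc n → Euc n) (f : Euc n → ℝ), ∀ x ∉ tsupport φ,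
        weakIntegrand b f φ x = 0 := fun b f x hx => by
      have h1 : φ x = 0 := image_eq_zero_of_notMem_tsupport hx
      have h2 : fderiv ℝ φ x = 0 := by
        by_contra h
        exact hx (support_fderiv_subset ℝ h)
      simp [weakIntegrand, h1, h2]
    rw [setIntegral_eq_integral_of_forall_compl_eq_zero fun x hx => hoff B u x fun h =>
      hx (ball_subset_ball hR'1.le (hφs h))]
    refine integral_congr_ae (Eventually.of_forall fun x => ?_)
    by_cases hx : x ∈ tsupport φ
    · have h1 := hζone x (hφs hx)
      have h2 : U =ᶠ[𝓝 x] u := h1.mono fun y hy => by simp only [hU, hy, one_mul]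
      simp only [weakIntegrand, h2.fderiv_eq, hA, h1.self_of_nhds, one_smul]
    · simp only [hoff _ _ x hx]
  have h := le_of_weak_subsolution hn hRR' hR0 hε.le hAs hAc hK hdivA hUdiff hUi hdUi hUε hwk
    x₀ hx₀0
  have h1 := (hζone x₀ (mem_ball_zero_iff.2 (hx₀R.trans hRR'))).self_of_nhds
  simpa only [hU, h1, one_mul] using h

/-- The class of functions to which the comparison principle applies: differentiable on the
punctured unit ball, of class `W^{1,1}`, and with zero boundary values. -/
structure VanishingAtBoundary {n : ℕ} (u : Euc n → ℝ) : Prop where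
  differentiableAt : ∀ x ∈ ball (0 : Euc n) 1, x ≠ 0 → DifferentiableAt ℝ u x
  integrableOn : IntegrableOn u (ball 0 1)
  integrableOn_fderiv : IntegrableOn (fderiv ℝ u) (ball 0 1)
  abs_lt : ∀ ε > 0, ∃ t < (1 : ℝ), ∀ x ∈ ball (0 : Euc n) 1, t < ‖x‖ → |u x| < ε

theorem mul_le_mul_of_weak_comparison {n : ℕ} (hn : 3 ≤ n) {B : Euc n → Euc n}
    (hB : ContDiffOn ℝ 1 B (ball 0 1)) (hdiv : ∀ x ∈ ball (0 : Euc n) 1, divg B x ≤ 0)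
    {u w : Euc n → ℝ} (hu : VanishingAtBoundary u) (hw : VanishingAtBoundary w) (a b : ℝ)
    (h : ∀ φ : Euc n → ℝ, ContDiff ℝ (⊤ : ℕ∞) φ → HasCompactSupport φ →
      tsupport φ ⊆ ball 0 1 → (∀ x, 0 ≤ φ x) →
      a * ∫ x in ball (0 : Euc n) 1, weakIntegrand B u φ x ≤
        b * ∫ x in ball (0 : Euc n) 1, weakIntegrand B w φ x)
    {x : Euc n} (hx : x ∈ ball (0 : Euc n) 1) (hx0 : x ≠ 0) : a * u x ≤ b * w x := by
  have hder : ∀ x ∈ ball (0 : Euc n) 1, x ≠ 0 → HasFDerivAt (fun y => a * u y - b * w y)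
      (a • fderiv ℝ u x - b • fderiv ℝ w x) x := fun x hx hx0 =>
    ((hu.differentiableAt x hx hx0).hasFDerivAt.const_mul a).sub
      ((hw.differentiableAt x hx hx0).hasFDerivAt.const_mul b)
  have key := nonpos_of_weak_subsolution hn hB hdiv (u := fun y => a * u y - b * w y)
    (fun x hx hx0 => (hder x hx hx0).differentiableAt)
    ((hu.integrableOn.const_mul a).sub (hw.integrableOn.const_mul b)) ?_ ?_ ?_ x hx hx0
  · linarith
  · refine Integrable.congr ((hu.integrableOn_fderiv.smul a).sub (hw.integrableOn_fderiv.smul b)) ?_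
    filter_upwards [ae_restrict_mem measurableSet_ball, ae_restrict_of_ae (Euc.ae_ne_zero hn)]
      with x hx hx0
    rw [(hder x hx hx0).fderiv]
    rfl
  · intro ε hε
    have hs : 0 < |a| + |b| + 1 := by positivity
    obtain ⟨t₁, ht₁, h₁⟩ := hu.abs_lt (ε / (|a| + |b| + 1)) (by positivity)
    obtain ⟨t₂, ht₂, h₂⟩ := hw.abs_lt (ε / (|a| + |b| + 1)) (by positivity)
    refine ⟨max t₁ t₂, max_lt ht₁ ht₂, fun x hx hxt => ?_⟩
    have e₁ := h₁ x hx ((le_max_left _ _).trans_lt hxt)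
    have e₂ := h₂ x hx ((le_max_right _ _).trans_lt hxt)
    have f₁ : a * u x ≤ |a| * (ε / (|a| + |b| + 1)) :=
      (le_abs_self _).trans (by rw [abs_mul]; gcongr)
    have f₂ : -(b * w x) ≤ |b| * (ε / (|a| + |b| + 1)) :=
      (neg_le_abs _).trans (by rw [abs_mul]; gcongr)
    have f₃ : (|a| + |b| + 1) * (ε / (|a| + |b| + 1)) = ε := by field_simp
    have f₄ : 0 < ε / (|a| + |b| + 1) := by positivity
    nlinarith
  · intro φ hφ hφc hφs hφ0
    have hi := fun {f : Euc n → ℝ} (hf : VanishingAtBoundary f) =>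
      integrableOn_weakIntegrand hB.continuousOn hf.integrableOn_fderiv hφ hφc hφs
    have e : ∫ x in ball (0 : Euc n) 1, weakIntegrand B (fun y => a * u y - b * w y) φ x =
        (a * ∫ x in ball (0 : Euc n) 1, weakIntegrand B u φ x) -
        b * ∫ x in ball (0 : Euc n) 1, weakIntegrand B w φ x := by
      rw [← integral_const_mul, ← integral_const_mul,
        ← integral_sub ((hi hu).const_mul a) ((hi hw).const_mul b)]
      refine integral_congr_ae ?_
      filter_upwards [ae_restrict_mem measurableSet_ball, ae_restrict_of_ae (Euc.ae_ne_zero hn)]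
        with x hx hx0
      simp only [weakIntegrand, (hder x hx hx0).fderiv, mul_add, Finset.mul_sum]
      rw [add_sub_add_comm, ← Finset.sum_sub_distrib]
      congr 1
      · refine Finset.sum_congr rfl fun i _ => ?_
        simp
        ring
      · simp
        ring
    rw [e]
    linarith [h φ hφ hφc hφs hφ0]

theorem vanishingAtBoundary_radialGreen {n : ℕ} (hn : 3 ≤ n) {β : ℝ} (hβ : 0 < β) (m : ℝ) :
    VanishingAtBoundary fun x : Euc n => radialGreen n β m ‖x‖ where
  differentiableAt x _ hx0 := (hasFDerivAt_radialGreen_norm m hβ hx0).differentiableAt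
  integrableOn := integrableOn_radialGreen_norm m hn hβ
  integrableOn_fderiv := integrableOn_fderiv_radialGreen_norm m hn hβ
  abs_lt ε hε := by
    obtain ⟨t, ht, h⟩ := exists_radialGreen_lt (n := n) m hβ hε
    exact ⟨t, ht, fun x hx hxt => h _ hxt (mem_ball_zero_iff.1 hx)⟩

theorem IsGreenPole.vanishingAtBoundary {n : ℕ} {B : Euc n → Euc n} {g : Euc n → ℝ}
    (hg : IsGreenPole B 0 g) : VanishingAtBoundary g where
  differentiableAt x hx hx0 := (hg.2.1.contDiffAt ((isOpen_ball.sdiff isClosed_singleton).mem_nhds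
    ⟨hx, hx0⟩)).differentiableAt (by simp)
  integrableOn := hg.2.2.1
  integrableOn_fderiv := by
    refine hg.2.2.2.1.mono' (measurable_fderiv ℝ g).aestronglyMeasurable
      (Eventually.of_forall fun x => ?_)
    rw [gradient, LinearIsometryEquiv.norm_map]
  abs_lt := hg.2.2.2.2.1

theorem IsGreenPole.integral_weakIntegrand {n : ℕ} {B : Euc n → Euc n} {g : Euc n → ℝ}
    (hg : IsGreenPole B 0 g) {φ : Euc n → ℝ} (hφ : ContDiff ℝ (⊤ : ℕ∞) φ)
    (hφc : HasCompactSupport φ) (hφs : tsupport φ ⊆ ball 0 1) :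
    ∫ x in ball (0 : Euc n) 1, weakIntegrand B g φ x = φ 0 := by
  rw [← hg.2.2.2.2.2 φ hφ hφc hφs]
  refine integral_congr_ae (Eventually.of_forall fun x => ?_)
  have h1 : ∀ (f : Euc n → ℝ) (i : Fin n),
      gradient f x i = fderiv ℝ f x (EuclideanSpace.single i 1) := fun f i => by
    rw [← inner_gradient_left, EuclideanSpace.inner_single_right]
    simp
  simp only [weakIntegrand, inner_gradient_right, conj_trivial]
  rw [clm_apply_eq_sum (fderiv ℝ φ x) (gradient g x)]
  simp_rw [h1, mul_comm]

/-- Two-sided comparison of a Green's function with the radial barriers. -/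
theorem IsGreenPole.radialGreen_bounds {n : ℕ} (hn : 3 ≤ n) {β M : ℝ} (hβ : 0 < β)
    {B : Euc n → Euc n} (hB : AdmissibleDrift β M B) {g : Euc n → ℝ} (hg : IsGreenPole B 0 g)
    {x : Euc n} (hx : x ∈ ball (0 : Euc n) 1) (hx0 : x ≠ 0) :
    (volume : Measure (Euc n)).toSphere.real univ * radialWeight β M 0 * g x ≤
      radialGreen n β M ‖x‖ ∧
    radialGreen n β (-M) ‖x‖ ≤
      (volume : Measure (Euc n)).toSphere.real univ * radialWeight β (-M) 0 * g x := by
  have hdiv : ∀ x ∈ ball (0 : Euc n) 1, divg B x ≤ 0 := fun x hx => (hB.2.2 x hx).2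
  constructor
  · rw [← one_mul (radialGreen n β M ‖x‖)]
    refine mul_le_mul_of_weak_comparison hn hB.1 hdiv hg.vanishingAtBoundary
      (vanishingAtBoundary_radialGreen hn hβ M) _ 1 (fun φ hφ hφc hφs hφ0 => ?_) hx hx0
    rw [hg.integral_weakIntegrand hφ hφc hφs, one_mul]
    exact (mul_le_integral_weakIntegrand_radialGreen hn hβ hB hφ hφc hφs hφ0).1
  · rw [← one_mul (radialGreen n β (-M) ‖x‖)]
    refine mul_le_mul_of_weak_comparison hn hB.1 hdiv (vanishingAtBoundary_radialGreen hn hβ (-M))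
      hg.vanishingAtBoundary 1 _ (fun φ hφ hφc hφs hφ0 => ?_) hx hx0
    rw [hg.integral_weakIntegrand hφ hφc hφs, one_mul]
    exact (mul_le_integral_weakIntegrand_radialGreen hn hβ hB hφ hφc hφs hφ0).2

theorem toSphere_real_univ_pos {n : ℕ} (hn : 3 ≤ n) :
    0 < (volume : Measure (Euc n)).toSphere.real univ := by
  have := Euc.nontrivial hn
  rw [Measure.toSphere_real_apply_univ]
  refine mul_pos (by simp; omega) ?_
  exact ENNReal.toReal_pos (measure_ball_pos _ _ one_pos).ne' measure_ball_lt_top.ne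

/-- there are constants `L ≥ 2` and `η > 0`, depending only on `n`, `M`, `β`,
such that for every admissible drift and Green's function `g` with pole at `0`, setting
`s* = max {g(x) : |x| = 1/L}`, the set `{x ∈ Ω : g(x) ≥ 2 s*}` has Lebesgue measure at
least `η` times the measure of `B(0, 1/L)`. -/
theorem level_set_measure_lower_bound
    (n : ℕ) (hn : 3 ≤ n) (β M : ℝ) (hβ0 : 0 < β) (hβ1 : β < 1) (hM : 0 < M) :
    ∃ L η : ℝ, 2 ≤ L ∧ 0 < η ∧
      ∀ (B : Euc n → Euc n) (g : Euc n → ℝ),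
        AdmissibleDrift β M B → IsGreenPole B (0 : Euc n) g →
        ENNReal.ofReal η * volume (ball (0 : Euc n) (1 / L)) ≤
          volume {x : Euc n |
            x ∈ ball (0 : Euc n) 1 ∧ x ≠ 0 ∧
              2 * sSup (g '' sphere (0 : Euc n) (1 / L)) ≤ g x} := by
  have := Euc.nontrivial hn
  set σ := (volume : Measure (Euc n)).toSphere.real univ with hσ
  have hσ0 : 0 < σ := toSphere_real_univ_pos hn
  set a : ℝ := σ * radialWeight β M 0 with ha
  set b : ℝ := σ * radialWeight β (-M) 0 with hb
  have ha0 : 0 < a := mul_pos hσ0 (radialWeight_pos _ _ _)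
  have hb0 : 0 < b := mul_pos hσ0 (radialWeight_pos _ _ _)
  set S : ℝ := radialGreen n β M (1 / 2) / a with hS
  have hS0 : 0 ≤ S := div_nonneg (radialGreen_nonneg M (by norm_num) (by norm_num)) ha0.le
  obtain ⟨ρ, hρ0, hρ1, hρ⟩ : ∃ ρ : ℝ, 0 < ρ ∧ ρ ≤ 1 ∧ ∀ r, 0 < r → r < ρ →
      b * (2 * S) ≤ -Real.log r := by
    refine ⟨Real.exp (-(b * (2 * S))), Real.exp_pos _,
      Real.exp_le_one_iff.2 (by simp; positivity), fun r hr hrρ => ?_⟩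
    have := Real.log_lt_log hr hrρ
    rw [Real.log_exp] at this
    linarith
  refine ⟨2, (2 * ρ) ^ n, le_rfl, by positivity, fun B g hB hg => ?_⟩
  have hsup : sSup (g '' sphere (0 : Euc n) (1 / 2)) ≤ S := by
    refine csSup_le ((NormedSpace.sphere_nonempty.2 (by norm_num)).image g) ?_
    rintro _ ⟨x, hx, rfl⟩
    have hxn : ‖x‖ = 1 / 2 := by simpa using hx
    have hx1 : x ∈ ball (0 : Euc n) 1 := by
      rw [mem_ball_zero_iff, hxn]
      norm_num
    have hx0 : x ≠ 0 := by
      rw [← norm_pos_iff, hxn]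
      norm_num
    have h := (hg.radialGreen_bounds hn hβ0 hB hx1 hx0).1
    rw [hxn] at h
    rw [hS, le_div_iff₀ ha0, mul_comm]
    exact h
  have hsub : ball (0 : Euc n) ρ \ {0} ⊆ {x : Euc n | x ∈ ball (0 : Euc n) 1 ∧ x ≠ 0 ∧
      2 * sSup (g '' sphere (0 : Euc n) (1 / 2)) ≤ g x} := by
    rintro x ⟨hx, hx0⟩
    have hx0' : x ≠ 0 := hx0
    have hxρ := mem_ball_zero_iff.1 hx
    have hx1 : x ∈ ball (0 : Euc n) 1 := ball_subset_ball hρ1 hx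
    have hxp := norm_pos_iff.2 hx0'
    refine ⟨hx1, hx0', ?_⟩
    have h1 := (hg.radialGreen_bounds hn hβ0 hB hx1 hx0').2
    have h2 := neg_log_le_radialGreen (-M) hn hβ0 (by linarith) hxp (hxρ.le.trans hρ1)
    have h3 : b * (2 * S) ≤ b * g x := (hρ _ hxp hxρ).trans (h2.trans h1)
    have h4 := le_of_mul_le_mul_left h3 hb0
    linarith
  refine le_trans (le_of_eq ?_) (measure_mono hsub)
  rw [measure_sdiff_null (measure_singleton _),
    Measure.addHaar_ball_of_pos volume (0 : Euc n) hρ0,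
    Measure.addHaar_ball_of_pos volume (0 : Euc n) (show (0 : ℝ) < 1 / 2 by norm_num), ← mul_assoc,
    ← ENNReal.ofReal_mul (by positivity)]
  congr 2
  rw [finrank_euclideanSpace_fin, ← mul_pow]
  congr 1
  ring
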